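/- Let P be an abstract simplicial complex on a finite vertex set V whose geometric realization ‖P‖ is homeomorphic to the sphere S^{d−1}, and let K be a field. If I ⊆ V is a face of P, then H̃_{d−1−i}(P_{≤Î}; K) = 0 for every integer i ≥ 1, where Î = V∖I. -/

import Mathlib

open Finset

/-- An abstract simplicial complex on a vertex type `V`: a collection of finite subsets of `V`
(called faces) closed under taking subsets. -/
structure ASC (V : Type) where
  faces : Set (Finset V)
  down_closed : ∀ ⦃σ τ : Finset V⦄, σ ∈ faces → τ ⊆ σ → τ ∈ faces

namespace ASC

variable {V : Type}

/-- `Γ.restrict σ` is the subcomplex `Γ_{≤σ}` of all faces of `Γ` contained in `σ`. -/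
def restrict (Γ : ASC V) (σ : Finset V) : ASC V where
  faces := {τ | τ ∈ Γ.faces ∧ τ ⊆ σ}
  down_closed := by
    intro τ τ' h hsub
    exact ⟨Γ.down_closed h.1 hsub, hsub.trans h.2⟩

/-- The link of `σ` in `Γ`: all faces `τ` with `τ ∪ σ ∈ Γ` and `τ ∩ σ = ∅`. -/
def link [DecidableEq V] (Γ : ASC V) (σ : Finset V) : ASC V where
  faces := {τ | τ ∪ σ ∈ Γ.faces ∧ τ ∩ σ = ∅}
  down_closed := by
    intro τ τ' h hsub
    refine ⟨Γ.down_closed h.1 (Finset.union_subset_union hsub (Finset.Subset.refl σ)), ?_⟩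
    rw [← Finset.subset_empty, ← h.2]
    exact Finset.inter_subset_inter hsub (Finset.Subset.refl σ)

/-- The Alexander dual `Γ* = {σ ⊆ V ∣ V∖σ ∉ Γ}`. -/
def dual [DecidableEq V] [Fintype V] (Γ : ASC V) : ASC V where
  faces := {σ | σᶜ ∉ Γ.faces}
  down_closed := by
    intro σ τ hσ hsub hmem
    exact hσ (Γ.down_closed hmem (Finset.compl_subset_compl.mpr hsub))

/-- A maximal face (facet) of `Γ`. -/
def IsMaximalFace (Γ : ASC V) (τ : Finset V) : Prop :=
  τ ∈ Γ.faces ∧ ∀ τ' ∈ Γ.faces, τ ⊆ τ' → τ' = τ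

/-- A minimal non-face of `Γ`: not a face of `Γ`, but all of its proper subsets are faces. -/
def IsMinimalNonFace (Γ : ASC V) (J : Finset V) : Prop :=
  J ∉ Γ.faces ∧ ∀ J' ⊂ J, J' ∈ Γ.faces

/-- `I` belongs to `U_SR`: it is a union of (a nonempty finite family of)
minimal non-faces of `Γ`. -/
def memUSR [DecidableEq V] (Γ : ASC V) (I : Finset V) : Prop :=
  ∃ S : Finset (Finset V), S.Nonempty ∧ (∀ J ∈ S, Γ.IsMinimalNonFace J) ∧ I = S.sup id

section Homology

variable (K : Type) [Field K] [LinearOrder V]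

/-- The `j`-dimensional faces of `Γ` (faces of cardinality `j + 1`). -/
def Cells (Γ : ASC V) (j : ℤ) : Type :=
  {σ : Finset V // σ ∈ Γ.faces ∧ (σ.card : ℤ) = j + 1}

/-- The space of simplicial `j`-chains with coefficients in `K`, i.e. the free `K`-module on the
`j`-dimensional faces.  (This is the augmented/reduced chain complex: the empty face, if present,
spans the chains in degree `-1`.) -/
def Chains (Γ : ASC V) (j : ℤ) : Type := Cells Γ j →₀ K

noncomputable instance (Γ : ASC V) (j : ℤ) : AddCommGroup (Chains K Γ j) :=
  inferInstanceAs (AddCommGroup (Cells Γ j →₀ K))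

noncomputable instance (Γ : ASC V) (j : ℤ) : Module K (Chains K Γ j) :=
  inferInstanceAs (Module K (Cells Γ j →₀ K))

/-- The simplicial boundary map from `j`-chains to `k = (j-1)`-chains, with the usual
alternating signs determined by the linear order on the vertices. -/
noncomputable def boundary (Γ : ASC V) (j k : ℤ) (hk : k = j - 1) :
    Chains K Γ j →ₗ[K] Chains K Γ k :=
  Finsupp.lsum K fun σ : Cells Γ j =>
    LinearMap.toSpanSingleton K (Chains K Γ k)
      (∑ v ∈ σ.1.attach,
        (Finsupp.single
          (⟨σ.1.erase v.1,
            Γ.down_closed σ.2.1 (Finset.erase_subset _ _), by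
              have h1 := Finset.card_erase_of_mem v.2
              have h2 : 1 ≤ σ.1.card := Finset.card_pos.mpr ⟨v.1, v.2⟩
              have h3 := σ.2.2
              omega⟩ : Cells Γ k)
          ((-1 : K) ^ (σ.1.filter (fun w => w < v.1)).card) : Cells Γ k →₀ K))

/-- Reduced simplicial homology of `Γ` in degree `j` with coefficients in `K`:
cycles modulo (cycles that are boundaries). -/
noncomputable abbrev reducedHomology (Γ : ASC V) (j : ℤ) : Type :=
  ↥(LinearMap.ker (boundary K Γ j (j - 1) rfl)) ⧸
    Submodule.comap (LinearMap.ker (boundary K Γ j (j - 1) rfl)).subtype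
      (LinearMap.range (boundary K Γ (j + 1) j (by omega)))

/-- Simplicial `j`-cochains: the `K`-linear dual of the space of `j`-chains. -/
def Cochains (Γ : ASC V) (j : ℤ) : Type := Chains K Γ j →ₗ[K] K

noncomputable instance (Γ : ASC V) (j : ℤ) : AddCommGroup (Cochains K Γ j) :=
  inferInstanceAs (AddCommGroup (Chains K Γ j →ₗ[K] K))

noncomputable instance (Γ : ASC V) (j : ℤ) : Module K (Cochains K Γ j) :=
  inferInstanceAs (Module K (Chains K Γ j →ₗ[K] K))

/-- The simplicial coboundary map, the dual of the boundary map. -/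
noncomputable def coboundary (Γ : ASC V) (j k : ℤ) (hk : k = j + 1) :
    Cochains K Γ j →ₗ[K] Cochains K Γ k :=
  (boundary K Γ k j (by omega)).dualMap

/-- Reduced simplicial cohomology of `Γ` in degree `j` with coefficients in `K`:
cocycles modulo (cocycles that are coboundaries). -/
noncomputable abbrev reducedCohomology (Γ : ASC V) (j : ℤ) : Type :=
  ↥(LinearMap.ker (coboundary K Γ j (j + 1) rfl)) ⧸
    Submodule.comap (LinearMap.ker (coboundary K Γ j (j + 1) rfl)).subtype
      (LinearMap.range (coboundary K Γ (j - 1) j (by omega)))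

end Homology

/-- The geometric realization `‖Γ‖` of `Γ`, as the subset of `V → ℝ` consisting of the
convex-weight functions whose support is a face of `Γ`. -/
def realization [Fintype V] (Γ : ASC V) : Set (V → ℝ) :=
  {x | (∀ v, 0 ≤ x v) ∧ (∑ v, x v) = 1 ∧ ∃ τ ∈ Γ.faces, ∀ v, x v ≠ 0 ↔ v ∈ τ}

end ASC

namespace ListChain

/-- Chains of ordered simplices (lists of vertices, repetitions allowed) with coefficients in `K`.
The empty list spans the chains in the augmentation degree. -/
abbrev Chain (K X : Type) [Field K] : Type := List X →₀ K

section Basic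

variable {K : Type} [Field K] {X Y W : Type}

/-- The cone operator prefixing every list with the vertex `a`. -/
noncomputable def cone (a : X) : Chain K X →ₗ[K] Chain K X :=
  Finsupp.lmapDomain K K (List.cons a)

/-- The boundary of a single ordered simplex. -/
noncomputable def bdList : List X → Chain K X
  | [] => 0
  | a :: l => Finsupp.single l 1 - cone a (bdList l)

/-- The boundary operator on ordered chains. -/
noncomputable def bd : Chain K X →ₗ[K] Chain K X :=
  Finsupp.linearCombination K bdList

/-- The map of ordered chains induced by a map of vertices. -/
noncomputable def push (f : X → Y) : Chain K X →ₗ[K] Chain K Y :=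
  Finsupp.lmapDomain K K (List.map f)

/-- Ordered chains all of whose simplices belong to `Q`. -/
noncomputable abbrev On (K : Type) [Field K] (Q : Set (List X)) : Submodule K (Chain K X) :=
  Finsupp.supported K K Q

/-- Lists of length `n` with entries in `S`. -/
def lists (n : ℕ) (S : Set X) : Set (List X) :=
  {l | l.length = n ∧ ∀ x ∈ l, x ∈ S}

/-- Lists of length `n` with entries in `S` at pairwise distance less than `ε`. -/
def smalls [PseudoMetricSpace X] (n : ℕ) (ε : ℝ) (S : Set X) : Set (List X) :=
  {l | l.length = n ∧ (∀ x ∈ l, x ∈ S) ∧ ∀ x ∈ l, ∀ y ∈ l, dist x y < ε}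

@[simp] lemma cone_single (a : X) (l : List X) (k : K) :
    cone a (Finsupp.single l k) = Finsupp.single (a :: l) k := by
  simp [cone, Finsupp.lmapDomain_apply, Finsupp.mapDomain_single]

@[simp] lemma push_single (f : X → Y) (l : List X) (k : K) :
    push f (Finsupp.single l k) = Finsupp.single (l.map f) k := by
  simp [push, Finsupp.lmapDomain_apply, Finsupp.mapDomain_single]

@[simp] lemma bd_single (l : List X) : bd (Finsupp.single l (1 : K)) = bdList l := by
  simp [bd]

lemma bd_cone (a : X) (c : Chain K X) : bd (cone a c) = c - cone a (bd c) := by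
  have : bd ∘ₗ cone a = LinearMap.id - cone a ∘ₗ (bd : Chain K X →ₗ[K] Chain K X) := by
    ext1 l; ext1
    simp [bdList]
  exact LinearMap.congr_fun this c

lemma bd_bd (c : Chain K X) : bd (bd c) = 0 := by
  have : bd ∘ₗ bd = (0 : Chain K X →ₗ[K] Chain K X) := by
    ext1 l; ext1
    simp only [LinearMap.comp_apply, Finsupp.lsingle_apply, bd_single, LinearMap.zero_apply]
    induction l with
    | nil => simp [bdList]
    | cons a l ih => simp [bdList, bd_cone, ih]
  exact LinearMap.congr_fun this c

lemma push_cone (f : X → Y) (a : X) (c : Chain K X) :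
    push f (cone a c) = cone (f a) (push f c) := by
  have : push f ∘ₗ cone a = cone (f a) ∘ₗ (push f : Chain K X →ₗ[K] Chain K Y) := by
    ext1 l; ext1
    simp
  exact LinearMap.congr_fun this c

lemma bd_push (f : X → Y) (c : Chain K X) : bd (push f c) = push f (bd c) := by
  have : bd ∘ₗ push f = push f ∘ₗ (bd : Chain K X →ₗ[K] Chain K X) := by
    ext1 l; ext1
    simp only [LinearMap.comp_apply, Finsupp.lsingle_apply, bd_single, push_single]
    induction l with
    | nil => simp [bdList]
    | cons a l ih => simp [bdList, ih, push_cone]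
  exact LinearMap.congr_fun this c

lemma push_push (f : X → Y) (g : Y → W) (c : Chain K X) :
    push g (push f c) = push (g ∘ f) c := by
  have : push g ∘ₗ push f = (push (g ∘ f) : Chain K X →ₗ[K] Chain K W) := by
    ext1 l; ext1
    simp
  exact LinearMap.congr_fun this c

lemma single_mem {Q : Set (List X)} {l : List X} (h : l ∈ Q) (k : K) :
    Finsupp.single l k ∈ On K Q :=
  Finsupp.single_mem_supported K k h

lemma On_mono {Q R : Set (List X)} (h : Q ⊆ R) : On K Q ≤ On K R :=
  Finsupp.supported_mono h

lemma map_mem {M : Type} [AddCommGroup M] [Module K M] (F : Chain K X →ₗ[K] M)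
    {Q : Set (List X)} {N : Submodule K M} (h : ∀ l ∈ Q, F (Finsupp.single l 1) ∈ N)
    {c : Chain K X} (hc : c ∈ On K Q) : F c ∈ N := by
  rw [On, Finsupp.supported_eq_span_single] at hc
  have : Submodule.span K ((fun i => Finsupp.single i (1 : K)) '' Q) ≤ N.comap F := by
    rw [Submodule.span_le]
    rintro _ ⟨l, hl, rfl⟩
    exact h l hl
  exact this hc

lemma map_eq {M : Type} [AddCommGroup M] [Module K M] (F G : Chain K X →ₗ[K] M)
    {Q : Set (List X)} (h : ∀ l ∈ Q, F (Finsupp.single l 1) = G (Finsupp.single l 1))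
    {c : Chain K X} (hc : c ∈ On K Q) : F c = G c := by
  have := map_mem (F - G) (N := ⊥) (fun l hl => by simp [h l hl]) hc
  simpa [sub_eq_zero] using this

lemma push_congr {f g : X → Y} {Q : Set (List X)} (h : ∀ l ∈ Q, ∀ x ∈ l, f x = g x)
    {c : Chain K X} (hc : c ∈ On K Q) : push f c = push g c := by
  refine map_eq (push f) (push g) (fun l hl => ?_) hc
  rw [push_single, push_single, List.map_congr_left (h l hl)]

lemma push_eq_self (f : X → X) {Q : Set (List X)} (h : ∀ l ∈ Q, ∀ x ∈ l, f x = x)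
    {c : Chain K X} (hc : c ∈ On K Q) : push f c = c := by
  refine map_eq (push f) LinearMap.id (fun l hl => ?_) hc
  have : l.map f = l := by
    conv_rhs => rw [← List.map_id l]
    exact List.map_congr_left (h l hl)
  simp [this]

lemma push_mem (f : X → Y) {Q : Set (List X)} {R : Set (List Y)} (h : ∀ l ∈ Q, l.map f ∈ R)
    {c : Chain K X} (hc : c ∈ On K Q) : push f c ∈ On K R :=
  map_mem _ (fun l hl => by rw [push_single]; exact single_mem (h l hl) 1) hc

lemma bdList_mem (l : List X) :
    (bdList l : Chain K X) ∈ On K {m | m.Sublist l ∧ m.length + 1 = l.length} := by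
  induction l with
  | nil => exact Submodule.zero_mem _
  | cons a l ih =>
    refine Submodule.sub_mem _
      (single_mem (Q := {m | m.Sublist (a :: l) ∧ m.length + 1 = (a :: l).length})
        ⟨List.sublist_cons_self a l, rfl⟩ 1) ?_
    refine map_mem _ (fun m hm => ?_) ih
    rw [cone_single]
    exact single_mem (Q := {m | m.Sublist (a :: l) ∧ m.length + 1 = (a :: l).length})
      ⟨hm.1.cons_cons a, by simp [hm.2]⟩ 1

lemma bd_mem {Q R : Set (List X)}
    (h : ∀ l ∈ Q, ∀ m : List X, m.Sublist l → m.length + 1 = l.length → m ∈ R)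
    {c : Chain K X} (hc : c ∈ On K Q) : bd c ∈ On K R := by
  refine map_mem _ (fun l hl => ?_) hc
  rw [bd_single]
  exact On_mono (fun m hm => h l hl m hm.1 hm.2) (bdList_mem l)

lemma lists_acyclic {n : ℕ} {S : Set X} (hS : S.Nonempty) {c : Chain K X}
    (hc : c ∈ On K (lists n S)) (hb : bd c = 0) :
    ∃ b ∈ On K (lists (n + 1) S), bd b = c := by
  obtain ⟨a, ha⟩ := hS
  refine ⟨cone a c, map_mem _ (fun l hl => ?_) hc, by simp [bd_cone, hb]⟩
  rw [cone_single]
  refine single_mem (Q := lists (n + 1) S) ⟨by simp [hl.1], ?_⟩ 1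
  simpa [ha] using hl.2

/-- Values on simplices, chosen by recursion on the length, of an operator subject to a prescribed
carrier and a prescribed boundary relation. -/
noncomputable def liftAux (κ : K) (g : Chain K X →ₗ[K] Chain K Y)
    (Φ : List X → ℕ → Submodule K (Chain K Y)) (k : ℕ) (c₀ : Chain K Y) :
    ℕ → List X → Chain K Y
  | 0, _ => c₀
  | n + 1, l => Classical.epsilon fun b => b ∈ Φ l (n + 1 + k) ∧
      bd b = g (Finsupp.single l 1) +
        κ • Finsupp.linearCombination K (liftAux κ g Φ k c₀ n) (bdList l)

/-- The method of acyclic carriers. -/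
theorem exists_carried (κ : K) (g : Chain K X →ₗ[K] Chain K Y)
    (hg : ∀ c, bd (g c) + κ • g (bd c) = 0)
    (Φ : List X → ℕ → Submodule K (Chain K Y)) (k : ℕ)
    (mono : ∀ l' l n, l'.Sublist l → Φ l' n ≤ Φ l n)
    (acyc : ∀ l, l ≠ [] → ∀ n, ∀ c ∈ Φ l n, bd c = 0 → ∃ b ∈ Φ l (n + 1), bd b = c)
    (hgΦ : ∀ a l, g (Finsupp.single (a :: l) 1) ∈ Φ (a :: l) (l.length + k))
    (c₀ : Chain K Y) (hc₀ : c₀ ∈ Φ [] k) (hbc₀ : bd c₀ = g (Finsupp.single [] 1)) :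
    ∃ F : Chain K X →ₗ[K] Chain K Y, F (Finsupp.single [] 1) = c₀ ∧
      (∀ l, F (Finsupp.single l 1) ∈ Φ l (l.length + k)) ∧
      ∀ c, bd (F c) = g c + κ • F (bd c) := by
  set A := liftAux κ g Φ k c₀ with hA
  set F : Chain K X →ₗ[K] Chain K Y := Finsupp.linearCombination K (fun l => A l.length l)
    with hF
  have hF1 : ∀ l, F (Finsupp.single l 1) = A l.length l := fun l => by simp [hF]
  have key : ∀ n, ∀ l : List X, l.length = n → F (Finsupp.single l 1) ∈ Φ l (n + k) ∧
      bd (F (Finsupp.single l 1)) = g (Finsupp.single l 1) + κ • F (bdList l) := by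
    intro n
    induction n with
    | zero =>
      intro l hl
      obtain rfl := List.length_eq_zero_iff.mp hl
      rw [hF1]
      simpa [hA, liftAux, bdList] using ⟨hc₀, hbc₀⟩
    | succ n ih =>
      intro l hl
      have hfaces := bdList_mem (K := K) l
      have e1 : Finsupp.linearCombination K (A n) (bdList l) = F (bdList l) := by
        refine map_eq _ _ (fun m hm => ?_) hfaces
        have : m.length = n := by have := hm.2; omega
        rw [hF1, this]; simp
      have e2 : bd (F (bdList l)) = g (bdList l) + κ • F (bd (bdList l)) := by
        refine map_eq (bd ∘ₗ F) (g + κ • F ∘ₗ bd) (fun m hm => ?_) hfaces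
        have : m.length = n := by have := hm.2; omega
        simpa using (ih m this).2
      have e3 : bd (bdList l : Chain K X) = 0 := by rw [← bd_single, bd_bd]
      have e4 : F (bdList l) ∈ Φ l (n + k) := by
        refine map_mem _ (fun m hm => ?_) hfaces
        have : m.length = n := by have := hm.2; omega
        exact mono _ _ _ hm.1 (ih m this).1
      have ex : ∃ b, b ∈ Φ l (n + 1 + k) ∧
          bd b = g (Finsupp.single l 1) + κ • Finsupp.linearCombination K (A n) (bdList l) := by
        rw [e1]
        have h5 : g (Finsupp.single l 1) + κ • F (bdList l) ∈ Φ l (n + k) := by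
          refine Submodule.add_mem _ ?_ (Submodule.smul_mem _ _ e4)
          match l, hl with
          | a :: l, hl =>
            have := hgΦ a l
            rwa [show l.length = n by simpa using hl] at this
        have h6 : bd (g (Finsupp.single l 1) + κ • F (bdList l)) = 0 := by
          rw [map_add, map_smul, e2, e3]
          have := hg (Finsupp.single l 1)
          simpa using this
        obtain ⟨b, hb, hb'⟩ := acyc l (by rintro rfl; simp at hl) _ _ h5 h6
        exact ⟨b, by rwa [show n + 1 + k = n + k + 1 by omega], hb'⟩
      have sp := Classical.epsilon_spec ex
      rw [hF1, hl, ← e1]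
      exact sp
  refine ⟨F, by simp [hF1, hA, liftAux], fun l => (key _ l rfl).1, fun c => ?_⟩
  refine map_eq (bd ∘ₗ F) (g + κ • F ∘ₗ bd) (Q := Set.univ) (fun l _ => ?_) (by simp)
  simpa using (key _ l rfl).2

/-- Two augmentation preserving chain maps carried by the same full simplices are homotopic. -/
theorem exists_homotopy (f g : Chain K X →ₗ[K] Chain K Y)
    (hf : ∀ c, bd (f c) = f (bd c)) (hg : ∀ c, bd (g c) = g (bd c))
    (h0 : f (Finsupp.single [] 1) = g (Finsupp.single [] 1))
    (S : List X → Set Y) (mono : ∀ l' l, l'.Sublist l → S l' ⊆ S l)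
    (ne : ∀ l, l ≠ [] → (S l).Nonempty)
    (hfS : ∀ l, f (Finsupp.single l 1) ∈ On K (lists l.length (S l)))
    (hgS : ∀ l, g (Finsupp.single l 1) ∈ On K (lists l.length (S l))) :
    ∃ T : Chain K X →ₗ[K] Chain K Y,
      (∀ l, T (Finsupp.single l 1) ∈ On K (lists (l.length + 1) (S l))) ∧
      ∀ c, bd c = 0 → bd (T c) = f c - g c := by
  obtain ⟨T, -, h1, h2⟩ := exists_carried (-1 : K) (f - g)
    (fun c => by simp [hf, hg]) (fun l n => On K (lists n (S l))) 1
    (fun l' l n h => On_mono (Q := lists n (S l')) (R := lists n (S l))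
      fun m hm => ⟨hm.1, fun x hx => mono _ _ h (hm.2 x hx)⟩)
    (fun l hl n c hc hb => lists_acyclic (ne l hl) hc hb)
    (fun a l => Submodule.sub_mem _ (hfS _) (hgS _)) 0 (Submodule.zero_mem _)
    (by simp [h0])
  exact ⟨T, h1, fun c hc => by rw [h2, hc]; simp⟩

end Basic

section Small

variable {K : Type} [Field K] {X Y : Type}

lemma smalls_mono [PseudoMetricSpace X] {n : ℕ} {ε ε' : ℝ} {S S' : Set X} (hε : ε ≤ ε')
    (hS : S ⊆ S') : smalls n ε S ⊆ smalls n ε' S' :=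
  fun _ hl => ⟨hl.1, fun x hx => hS (hl.2.1 x hx),
    fun x hx y hy => (hl.2.2 x hx y hy).trans_le hε⟩

lemma push_smalls [PseudoMetricSpace X] [PseudoMetricSpace Y] {f : X → Y} {n : ℕ} {ε ε' : ℝ}
    {S : Set X} {S' : Set Y} (hS : ∀ x ∈ S, f x ∈ S')
    (h : ∀ x ∈ S, ∀ y ∈ S, dist x y < ε → dist (f x) (f y) < ε') {c : Chain K X}
    (hc : c ∈ On K (smalls n ε S)) : push f c ∈ On K (smalls n ε' S') := by
  refine push_mem (R := smalls n ε' S') f (fun l hl => ⟨by simp [hl.1], ?_, ?_⟩) hc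
  · simp only [List.mem_map]
    rintro _ ⟨x, hx, rfl⟩
    exact hS x (hl.2.1 x hx)
  · simp only [List.mem_map]
    rintro _ ⟨x, hx, rfl⟩ _ ⟨y, hy, rfl⟩
    exact h x (hl.2.1 x hx) y (hl.2.1 y hy) (hl.2.2 x hx y hy)

lemma bd_smalls [PseudoMetricSpace X] {n : ℕ} {ε : ℝ} {S : Set X} {c : Chain K X}
    (hc : c ∈ On K (smalls (n + 1) ε S)) : bd c ∈ On K (smalls n ε S) := by
  refine bd_mem (R := smalls n ε S) (fun l hl m hm hlen => ⟨?_, fun x hx => hl.2.1 x (hm.subset hx),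
    fun x hx y hy => hl.2.2 x (hm.subset hx) y (hm.subset hy)⟩) hc
  have := hl.1
  omega

lemma push_homotopic (f g : X → Y) {Q : Set (List X)} {R : Set (List Y)}
    (h : ∀ l ∈ Q, lists (l.length + 1) (f '' {x | x ∈ l} ∪ g '' {x | x ∈ l}) ⊆ R)
    {c : Chain K X} (hc : c ∈ On K Q) (hb : bd c = 0) :
    ∃ b ∈ On K R, bd b = push f c - push g c := by
  obtain ⟨T, hT, hTb⟩ := exists_homotopy (K := K) (push f) (push g) (bd_push f) (bd_push g)
    (by simp) (fun l => f '' {x | x ∈ l} ∪ g '' {x | x ∈ l})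
    (fun l' l hl => Set.union_subset_union (Set.image_mono fun x hx => hl.subset hx)
      (Set.image_mono fun x hx => hl.subset hx))
    (fun l hl => by
      obtain ⟨a, ha⟩ := List.exists_mem_of_ne_nil l hl
      exact ⟨f a, Or.inl ⟨a, ha, rfl⟩⟩)
    (fun l => by
      rw [push_single]
      refine single_mem (Q := lists l.length (f '' {x | x ∈ l} ∪ g '' {x | x ∈ l}))
        ⟨by simp, fun y hy => ?_⟩ 1
      obtain ⟨x, hx, rfl⟩ := List.mem_map.mp hy
      exact Or.inl ⟨x, hx, rfl⟩)
    (fun l => by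
      rw [push_single]
      refine single_mem (Q := lists l.length (f '' {x | x ∈ l} ∪ g '' {x | x ∈ l}))
        ⟨by simp, fun y hy => ?_⟩ 1
      obtain ⟨x, hx, rfl⟩ := List.mem_map.mp hy
      exact Or.inr ⟨x, hx, rfl⟩)
  exact ⟨T c, map_mem _ (fun l hl => On_mono (h l hl) (hT l)) hc, hTb c hb⟩

lemma exists_uniform_bounds [PseudoMetricSpace X] {ε : ℝ} (hε : 0 < ε) (s : Finset X) (p : X) :
    ∃ e R : ℝ, 0 < e ∧ e < ε ∧ 0 ≤ R ∧ (∀ x ∈ s, dist p x ≤ R) ∧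
      ∀ x ∈ s, ∀ y ∈ s, dist x y < ε → dist x y < e := by
  have h1 : ∀ᶠ e in nhdsWithin ε (Set.Iio ε), ∀ q ∈ s ×ˢ s, dist q.1 q.2 < ε →
      dist q.1 q.2 < e := by
    rw [Filter.eventually_all_finset]
    intro q _
    by_cases hq : dist q.1 q.2 < ε
    · filter_upwards [Ioo_mem_nhdsLT hq] with e he _ using he.1
    · exact Filter.Eventually.of_forall fun e h => absurd h hq
  obtain ⟨e, h2, h3⟩ := (h1.and (Ioo_mem_nhdsLT hε)).exists
  refine ⟨e, ∑ x ∈ s, dist p x, h3.1, h3.2, Finset.sum_nonneg fun _ _ => dist_nonneg,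
    fun x hx => Finset.single_le_sum (f := fun x => dist p x) (fun _ _ => dist_nonneg) hx,
    fun x hx y hy h => h2 (x, y) (Finset.mk_mem_product hx hy) h⟩

lemma smalls_acyclic_of_convex {E : Type} [NormedAddCommGroup E] [NormedSpace ℝ E] {C : Set E}
    (hC : Convex ℝ C) (hne : C.Nonempty) {ε : ℝ} (hε : 0 < ε) {n : ℕ} {c : Chain K E}
    (hc : c ∈ On K (smalls n ε C)) (hb : bd c = 0) :
    ∃ b ∈ On K (smalls (n + 1) ε C), bd b = c := by
  classical
  obtain ⟨p, hp⟩ := hne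
  obtain ⟨e, R, he, heε, hR, hsR, hse⟩ :=
    exists_uniform_bounds hε (c.support.biUnion List.toFinset) p
  have hcs : c ∈ On K (c.support : Set (List E)) := (Finsupp.mem_supported K c).mpr subset_rfl
  have hmem : ∀ l ∈ c.support, ∀ x ∈ l, x ∈ c.support.biUnion List.toFinset := fun l hl x hx =>
    Finset.mem_biUnion.mpr ⟨l, hl, List.mem_toFinset.mpr hx⟩
  have hQ : ∀ l ∈ c.support, l ∈ smalls n ε C := fun l hl =>
    (Finsupp.mem_supported K c).mp hc hl
  obtain ⟨N, hN⟩ := exists_nat_gt (R / (ε - e))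
  have hN0 : (0 : ℝ) < N := lt_of_le_of_lt (div_nonneg hR (by linarith)) hN
  have hRN : R / N < ε - e := by
    rw [div_lt_iff₀ hN0]; rw [div_lt_iff₀ (by linarith)] at hN; linarith
  let f : ℝ → E → E := fun s x => AffineMap.lineMap p x s
  have hfC : ∀ s : ℝ, 0 ≤ s → s ≤ 1 → ∀ x ∈ C, f s x ∈ C := fun s h0 h1 x hx =>
    hC.lineMap_mem hp hx ⟨h0, h1⟩
  have hfd : ∀ s t : ℝ, 0 ≤ s → s ≤ 1 → |s - t| ≤ 1 / N → ∀ l ∈ c.support, ∀ x ∈ l, ∀ y ∈ l,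
      dist (f s x) (f t y) < ε := by
    intro s t h0 h1 hst l hl x hx y hy
    have h2 : dist (f s x) (f s y) ≤ dist x y := by
      have : f s x - f s y = s • (x - y) := by
        simp only [f, AffineMap.lineMap_apply_module]; module
      rw [dist_eq_norm, this, norm_smul, ← dist_eq_norm, Real.norm_of_nonneg h0]
      exact mul_le_of_le_one_left dist_nonneg h1
    have h3 : dist (f s y) (f t y) ≤ R / N := by
      simp only [f, dist_lineMap_lineMap]
      calc dist s t * dist p y ≤ (1 / N) * R :=
            mul_le_mul hst (hsR y (hmem l hl y hy)) dist_nonneg (by positivity)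
        _ = R / N := by ring
    have h4 := hse x (hmem l hl x hx) y (hmem l hl y hy) ((hQ l hl).2.2 x hx y hy)
    have := dist_triangle (f s x) (f s y) (f t y)
    linarith
  have step : ∀ s t : ℝ, 0 ≤ s → s ≤ 1 → 0 ≤ t → t ≤ 1 → |s - t| ≤ 1 / N →
      ∃ b ∈ On K (smalls (n + 1) ε C), bd b = push (f s) c - push (f t) c := by
    intro s t hs0 hs1 ht0 ht1 hst
    refine push_homotopic (R := smalls (n + 1) ε C) (f s) (f t)
      (fun l hl m hm => ⟨?_, ?_, ?_⟩) hcs hb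
    · rw [hm.1, (hQ l hl).1]
    · intro x hx
      rcases hm.2 x hx with ⟨y, hy, rfl⟩ | ⟨y, hy, rfl⟩
      · exact hfC s hs0 hs1 y ((hQ l hl).2.1 y hy)
      · exact hfC t ht0 ht1 y ((hQ l hl).2.1 y hy)
    · have hst' : |t - s| ≤ 1 / N := by rwa [abs_sub_comm]
      have h0 : ∀ r : ℝ, |r - r| ≤ 1 / N := fun r => by rw [sub_self, abs_zero]; positivity
      intro x hx y hy
      rcases hm.2 x hx with ⟨x', hx', rfl⟩ | ⟨x', hx', rfl⟩ <;>
      rcases hm.2 y hy with ⟨y', hy', rfl⟩ | ⟨y', hy', rfl⟩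
      · exact hfd s s hs0 hs1 (h0 s) l hl x' hx' y' hy'
      · exact hfd s t hs0 hs1 hst l hl x' hx' y' hy'
      · exact hfd t s ht0 ht1 hst' l hl x' hx' y' hy'
      · exact hfd t t ht0 ht1 (h0 t) l hl x' hx' y' hy'
  have many : ∀ i : ℕ, i ≤ N →
      ∃ b ∈ On K (smalls (n + 1) ε C), bd b = push (f 1) c - push (f (1 - i / N)) c := by
    intro i
    induction i with
    | zero => exact fun _ => ⟨0, Submodule.zero_mem _, by simp⟩
    | succ i ih =>
      intro hi
      have hi' : ((i + 1 : ℕ) : ℝ) ≤ N := by exact_mod_cast hi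
      push_cast at hi'
      obtain ⟨b, hbm, hbb⟩ := ih (by omega)
      obtain ⟨b', hbm', hbb'⟩ := step (1 - i / N) (1 - (i + 1 : ℕ) / N)
        (by rw [sub_nonneg, div_le_one hN0]; linarith)
        (by have : (0 : ℝ) ≤ i / N := by positivity
            linarith)
        (by rw [sub_nonneg, div_le_one hN0]; push_cast; linarith)
        (by have : (0 : ℝ) ≤ (i + 1 : ℕ) / N := by positivity
            linarith)
        (by
          have : (1 - (i : ℝ) / N) - (1 - (i + 1 : ℕ) / N) = 1 / N := by push_cast; ring
          rw [this, abs_of_nonneg (by positivity)])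
      exact ⟨b + b', Submodule.add_mem _ hbm hbm', by rw [map_add, hbb, hbb']; abel⟩
  obtain ⟨b, hbm, hbb⟩ := many N le_rfl
  have e1 : push (f 1) c = c := push_eq_self _ (fun l _ x _ => by simp [f]) hcs
  have hz : push (f (1 - N / N)) c ∈ On K (lists n {p}) := by
    refine push_mem (R := lists n {p}) _ (fun l hl => ⟨by simp [(hQ l hl).1], ?_⟩) hcs
    simp [f, div_self hN0.ne']
  obtain ⟨b', hbm', hbb'⟩ := lists_acyclic (Set.singleton_nonempty p) hz
    (by rw [bd_push, hb, map_zero])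
  refine ⟨b + b', Submodule.add_mem _ hbm
    (On_mono (R := smalls (n + 1) ε C) (fun l hl => ⟨hl.1, ?_, ?_⟩) hbm'), ?_⟩
  · intro x hx
    rw [hl.2 x hx]; exact hp
  · intro x hx y hy
    rw [hl.2 x hx, hl.2 y hy, dist_self]; exact hε
  · rw [map_add, hbb, hbb', e1]; abel

/-- Arbitrarily fine subdivision of affine simplices. -/
lemma exists_subdivision (K : Type) [Field K] (E : Type) [NormedAddCommGroup E]
    [NormedSpace ℝ E] {ε : ℝ} (hε : 0 < ε) :
    ∃ s : Chain K E →ₗ[K] Chain K E, s (Finsupp.single [] 1) = Finsupp.single [] 1 ∧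
      (∀ l, s (Finsupp.single l 1) ∈ On K (smalls l.length ε (convexHull ℝ {x | x ∈ l}))) ∧
      ∀ c, bd (s c) = s (bd c) := by
  obtain ⟨s, h0, h1, h2⟩ := exists_carried (1 : K) (0 : Chain K E →ₗ[K] Chain K E) (by simp)
    (fun l n => On K (smalls n ε (convexHull ℝ {x | x ∈ l}))) 0
    (fun l' l n h => On_mono (smalls_mono le_rfl (convexHull_mono fun x hx => h.subset hx)))
    (fun l hl n c hc hb => by
      obtain ⟨a, ha⟩ := List.exists_mem_of_ne_nil l hl
      exact smalls_acyclic_of_convex (convex_convexHull ℝ _)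
        ⟨a, subset_convexHull ℝ _ ha⟩ hε hc hb)
    (fun a l => Submodule.zero_mem _) (Finsupp.single [] 1)
    (single_mem (Q := smalls 0 ε _) ⟨rfl, by simp, by simp⟩ 1) (by simp [bdList])
  exact ⟨s, h0, h1, fun c => by rw [h2]; simp⟩

end Small

section Bounding

variable {K : Type} [Field K] {X Y : Type} [MetricSpace X] [MetricSpace Y]

/-- Fine cycles on `n` vertices in `A` bound fine chains that stay in a compact set missing `D`. -/
def Bounds (K : Type) [Field K] {X : Type} [MetricSpace X] (n : ℕ) (A D : Set X) : Prop :=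
  ∃ B : Set X, IsCompact B ∧ Disjoint B D ∧ ∀ ε' > 0, ∃ ε > 0, ∀ c ∈ On K (smalls n ε A),
    bd c = 0 → ∃ b ∈ On K (smalls (n + 1) ε' B), bd b = c

lemma Bounds.of_disjoint_compl_point {E : Type} [NormedAddCommGroup E] [NormedSpace ℝ E]
    [ProperSpace E] {p : X} {φ : X → E} {ψ : E → X} (hφ : ContinuousOn φ {p}ᶜ)
    (hψ : Continuous ψ) (hψp : ∀ y, ψ y ≠ p) (hψφ : ∀ x, x ≠ p → ψ (φ x) = x) (n : ℕ) {A : Set X}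
    (hA : IsCompact A) (hAp : p ∉ A) : Bounds K n A {p} := by
  have hAsub : A ⊆ {p}ᶜ := fun x hx h => hAp (h ▸ hx)
  obtain ⟨R, hR⟩ := (hA.image_of_continuousOn (hφ.mono hAsub)).isBounded.subset_closedBall 0
  set C := Metric.closedBall (0 : E) (max R 0)
  have hC : IsCompact C := isCompact_closedBall _ _
  have hAC : ∀ x ∈ A, φ x ∈ C := fun x hx =>
    Metric.closedBall_subset_closedBall (le_max_left _ _) (hR ⟨x, hx, rfl⟩)
  refine ⟨ψ '' C, hC.image hψ, ?_, fun ε' hε' => ?_⟩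
  · rw [Set.disjoint_singleton_right]
    rintro ⟨y, _, hy⟩
    exact hψp y hy
  obtain ⟨δ, hδ, h1⟩ := Metric.uniformContinuousOn_iff.mp
    (hC.uniformContinuousOn_of_continuous hψ.continuousOn) ε' hε'
  obtain ⟨ε, hε, h2⟩ := Metric.uniformContinuousOn_iff.mp
    (hA.uniformContinuousOn_of_continuous (hφ.mono hAsub)) δ hδ
  refine ⟨ε, hε, fun c hc hb => ?_⟩
  obtain ⟨b, hbm, hbb⟩ := smalls_acyclic_of_convex (convex_closedBall (0 : E) (max R 0))
    (show C.Nonempty from ⟨0, by simp [C]⟩) hδ (push_smalls hAC h2 hc)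
    (by rw [bd_push, hb, map_zero])
  refine ⟨push ψ b, push_smalls (S' := ψ '' C) (fun x hx => Set.mem_image_of_mem ψ hx) h1 hbm, ?_⟩
  rw [bd_push, hbb, push_push]
  exact push_eq_self _ (fun l hl x hx => hψφ x (hAsub (hl.2.1 x hx))) hc

lemma exists_uniform_separation {C D₁ D₂ : Set X} (hC : IsCompact C) (h1 : IsClosed D₁)
    (h2 : IsClosed D₂) (ne1 : D₁.Nonempty) (ne2 : D₂.Nonempty) (hd : Disjoint C (D₁ ∩ D₂)) :
    ∃ δ > 0, ∀ x ∈ C, 2 * δ ≤ Metric.infDist x D₁ ∨ 2 * δ ≤ Metric.infDist x D₂ := by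
  rcases C.eq_empty_or_nonempty with rfl | hCne
  · exact ⟨1, one_pos, by simp⟩
  obtain ⟨x, hx, hmin⟩ := hC.exists_isMinOn hCne
    (f := fun x => max (Metric.infDist x D₁) (Metric.infDist x D₂))
    ((Metric.continuous_infDist_pt D₁).max (Metric.continuous_infDist_pt D₂)).continuousOn
  have hpos : 0 < max (Metric.infDist x D₁) (Metric.infDist x D₂) := by
    by_contra! hle
    have h3 := le_antisymm ((le_max_left _ _).trans hle) Metric.infDist_nonneg
    have h4 := le_antisymm ((le_max_right _ _).trans hle) Metric.infDist_nonneg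
    exact Set.disjoint_left.mp hd hx ⟨(h1.mem_iff_infDist_zero ne1).mpr h3,
      (h2.mem_iff_infDist_zero ne2).mpr h4⟩
  refine ⟨_, half_pos hpos, fun y hy => ?_⟩
  rw [mul_div_cancel₀ _ two_ne_zero]
  exact le_max_iff.mp (hmin hy)

/-- The Mayer–Vietoris argument for complements. -/
lemma Bounds.union {n : ℕ} {A D₁ D₂ : Set X} (h1 : IsClosed D₁) (h2 : IsClosed D₂)
    (ne1 : D₁.Nonempty) (ne2 : D₂.Nonempty) (H1 : Bounds K n A D₁) (H2 : Bounds K n A D₂)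
    (H : ∀ A' : Set X, IsCompact A' → Disjoint A' (D₁ ∩ D₂) → Bounds K (n + 1) A' (D₁ ∩ D₂)) :
    Bounds K n A (D₁ ∪ D₂) := by
  obtain ⟨B₁, hB₁, hd₁, H1⟩ := H1
  obtain ⟨B₂, hB₂, hd₂, H2⟩ := H2
  obtain ⟨C, hC, hCd, H⟩ := H (B₁ ∪ B₂) (hB₁.union hB₂)
    (Set.disjoint_union_left.mpr ⟨hd₁.mono_right Set.inter_subset_left,
      hd₂.mono_right Set.inter_subset_right⟩)
  obtain ⟨δ, hδ, hsep⟩ := exists_uniform_separation hC h1 h2 ne1 ne2 hCd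
  have far : ∀ D : Set X, IsCompact (C ∩ {x | δ ≤ Metric.infDist x D}) ∧
      Disjoint (C ∩ {x | δ ≤ Metric.infDist x D}) D := fun D => by
    refine ⟨hC.inter_right (isClosed_le continuous_const (Metric.continuous_infDist_pt D)), ?_⟩
    rw [Set.disjoint_left]
    rintro x ⟨_, hx⟩ hxD
    have h3 : δ ≤ Metric.infDist x D := hx
    rw [Metric.infDist_zero_of_mem hxD] at h3
    linarith
  set C₁ := C ∩ {x | δ ≤ Metric.infDist x D₁}
  set C₂ := C ∩ {x | δ ≤ Metric.infDist x D₂}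
  refine ⟨(B₁ ∪ C₁) ∩ (B₂ ∪ C₂), (hB₁.union (far D₁).1).inter (hB₂.union (far D₂).1), ?_,
    fun ε' hε' => ?_⟩
  · refine Set.disjoint_union_right.mpr ⟨?_, ?_⟩
    · exact (Set.disjoint_union_left.mpr ⟨hd₁, (far D₁).2⟩).mono_left Set.inter_subset_left
    · exact (Set.disjoint_union_left.mpr ⟨hd₂, (far D₂).2⟩).mono_left Set.inter_subset_right
  have hη : 0 < min ε' δ := lt_min hε' hδ
  obtain ⟨ε₃, hε₃, H⟩ := H _ hη
  have hη₃ : 0 < min ε₃ ε' := lt_min hε₃ hε'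
  obtain ⟨ε₁, hε₁, H1⟩ := H1 _ hη₃
  obtain ⟨ε₂, hε₂, H2⟩ := H2 _ hη₃
  refine ⟨min ε₁ ε₂, lt_min hε₁ hε₂, fun z hz hzb => ?_⟩
  obtain ⟨b₁, hb₁, e₁⟩ := H1 z (On_mono (smalls_mono (min_le_left _ _) subset_rfl) hz) hzb
  obtain ⟨b₂, hb₂, e₂⟩ := H2 z (On_mono (smalls_mono (min_le_right _ _) subset_rfl) hz) hzb
  obtain ⟨c, hc, ec⟩ := H (b₁ - b₂)
    (Submodule.sub_mem _
      (On_mono (smalls_mono (min_le_left _ _) Set.subset_union_left) hb₁)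
      (On_mono (smalls_mono (min_le_left _ _) Set.subset_union_right) hb₂))
    (by rw [map_sub, e₁, e₂, sub_self])
  have hsplit : c ∈ On K (smalls (n + 1 + 1) ε' C₁ ∪ smalls (n + 1 + 1) ε' C₂) := by
    refine On_mono (fun l hl => ?_) hc
    have hlen := hl.1
    obtain ⟨a, ha⟩ : ∃ a, a ∈ l := List.exists_mem_of_ne_nil l (by rintro rfl; simp at hlen)
    have small : ∀ x ∈ l, ∀ y ∈ l, dist x y < ε' := fun x hx y hy =>
      (hl.2.2 x hx y hy).trans_le (min_le_left _ _)
    have near : ∀ D : Set X, 2 * δ ≤ Metric.infDist a D → ∀ x ∈ l, δ ≤ Metric.infDist x D := by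
      intro D hD x hx
      have h3 := (hl.2.2 a ha x hx).trans_le (min_le_right _ _)
      have h4 : Metric.infDist a D ≤ Metric.infDist x D + dist a x :=
        Metric.infDist_le_infDist_add_dist
      linarith
    rcases hsep a (hl.2.1 a ha) with h | h
    · exact Or.inl ⟨hlen, fun x hx => ⟨hl.2.1 x hx, near _ h x hx⟩, small⟩
    · exact Or.inr ⟨hlen, fun x hx => ⟨hl.2.1 x hx, near _ h x hx⟩, small⟩
  rw [On, Finsupp.supported_union, Submodule.mem_sup] at hsplit
  obtain ⟨c₁, hc₁, c₂, hc₂, rfl⟩ := hsplit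
  have same : b₁ - bd c₁ = b₂ + bd c₂ := by
    rw [map_add] at ec
    rw [sub_eq_iff_eq_add, add_assoc, add_comm (bd c₂), ec]; abel
  refine ⟨b₁ - bd c₁, ?_, by rw [map_sub, bd_bd, e₁, sub_zero]⟩
  have m1 : b₁ - bd c₁ ∈ On K (smalls (n + 1) ε' (B₁ ∪ C₁)) := Submodule.sub_mem _
    (On_mono (smalls_mono (min_le_right _ _) Set.subset_union_left) hb₁)
    (On_mono (smalls_mono le_rfl Set.subset_union_right) (bd_smalls hc₁))
  have m2 : b₁ - bd c₁ ∈ On K (smalls (n + 1) ε' (B₂ ∪ C₂)) := by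
    rw [same]
    exact Submodule.add_mem _
      (On_mono (smalls_mono (min_le_right _ _) Set.subset_union_left) hb₂)
      (On_mono (smalls_mono le_rfl Set.subset_union_right) (bd_smalls hc₂))
  rw [Finsupp.mem_supported] at m1 m2 ⊢
  exact fun l hl => ⟨(m1 hl).1, fun x hx => ⟨(m1 hl).2.1 x hx, (m2 hl).2.1 x hx⟩, (m1 hl).2.2⟩

/-- Cutting `D` into thin slabs along a bounded function `t`. -/
lemma Bounds.of_slices {n : ℕ} {A D : Set X} (hD : IsCompact D) (hne : D.Nonempty) {t : X → ℝ}
    (ht : Continuous t) (ht01 : ∀ x ∈ D, t x ∈ Set.Icc (0 : ℝ) 1)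
    (hconn : ∀ x ∈ D, ∀ y ∈ D, ∀ r, t x ≤ r → r ≤ t y → ∃ z ∈ D, t z = r)
    (hA : IsCompact A) (hAD : Disjoint A D)
    (H : ∀ m r, ∀ A' : Set X, IsCompact A' → (D ∩ t ⁻¹' {r}).Nonempty →
      Disjoint A' (D ∩ t ⁻¹' {r}) → Bounds K m A' (D ∩ t ⁻¹' {r})) :
    Bounds K n A D := by
  have local_bound : ∀ r : ℝ, ∃ U : Set ℝ, IsOpen U ∧ r ∈ U ∧ ∀ a b, Set.Icc a b ⊆ U →
      (D ∩ t ⁻¹' Set.Icc a b) = ∅ ∨ Bounds K n A (D ∩ t ⁻¹' Set.Icc a b) := by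
    intro r
    rcases (D ∩ t ⁻¹' {r}).eq_empty_or_nonempty with he | hn
    · refine ⟨(t '' D)ᶜ, (hD.image ht).isClosed.isOpen_compl, ?_, fun a b hab => Or.inl ?_⟩
      · rintro ⟨x, hx, hxr⟩
        have : x ∈ D ∩ t ⁻¹' {r} := ⟨hx, hxr⟩
        simp [he] at this
      · rw [Set.eq_empty_iff_forall_notMem]
        rintro x ⟨hx, hxt⟩
        exact hab hxt ⟨x, hx, rfl⟩
    · obtain ⟨B, hB, hBd, HB⟩ := H n r A hA hn (hAD.mono_right Set.inter_subset_left)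
      refine ⟨(t '' (D ∩ B))ᶜ, ((hD.inter hB).image ht).isClosed.isOpen_compl, ?_,
        fun a b hab => Or.inr ⟨B, hB, ?_, HB⟩⟩
      · rintro ⟨x, ⟨hx, hxB⟩, hxr⟩
        exact Set.disjoint_left.mp hBd hxB ⟨hx, hxr⟩
      · rw [Set.disjoint_left]
        rintro x hxB ⟨hx, hxt⟩
        exact hab hxt ⟨x, ⟨hx, hxB⟩, rfl⟩
  choose U hUo hUr hU using local_bound
  obtain ⟨s, hs0, hsm, ⟨N, hN⟩, hs⟩ := exists_monotone_Icc_subset_open_cover_Icc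
    (zero_le_one' ℝ) (c := fun r => (Subtype.val : Set.Icc (0 : ℝ) 1 → ℝ) ⁻¹' U r)
    (fun r => (hUo r).preimage continuous_subtype_val)
    (fun x _ => Set.mem_iUnion.mpr ⟨x.1, hUr x.1⟩)
  have slab : ∀ k, (D ∩ t ⁻¹' Set.Icc (s k : ℝ) (s (k + 1))) = ∅ ∨
      Bounds K n A (D ∩ t ⁻¹' Set.Icc (s k : ℝ) (s (k + 1))) := by
    intro k
    obtain ⟨r, hr⟩ := hs k
    refine hU r _ _ fun x hx => ?_
    have hx01 : x ∈ Set.Icc (0 : ℝ) 1 := ⟨(s k).2.1.trans hx.1, hx.2.trans (s (k + 1)).2.2⟩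
    exact hr (show (⟨x, hx01⟩ : Set.Icc (0 : ℝ) 1) ∈ Set.Icc (s k) (s (k + 1)) from hx)
  have all : ∀ k, (D ∩ t ⁻¹' Set.Icc (s 0 : ℝ) (s k)) = ∅ ∨
      Bounds K n A (D ∩ t ⁻¹' Set.Icc (s 0 : ℝ) (s k)) := by
    intro k
    induction k with
    | zero =>
      rcases (D ∩ t ⁻¹' {(s 0 : ℝ)}).eq_empty_or_nonempty with he | hn
      · left; rwa [Set.Icc_self]
      · right
        rw [Set.Icc_self]
        exact H n _ A hA hn (hAD.mono_right Set.inter_subset_left)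
    | succ k ih =>
      have h0k : (s 0 : ℝ) ≤ s k := hsm (Nat.zero_le k)
      have hk1 : (s k : ℝ) ≤ s (k + 1) := hsm (Nat.le_succ k)
      have hun : D ∩ t ⁻¹' Set.Icc (s 0 : ℝ) (s (k + 1)) =
          (D ∩ t ⁻¹' Set.Icc (s 0 : ℝ) (s k)) ∪ (D ∩ t ⁻¹' Set.Icc (s k : ℝ) (s (k + 1))) := by
        rw [← Set.inter_union_distrib_left, ← Set.preimage_union, Set.Icc_union_Icc_eq_Icc h0k hk1]
      have hin : (D ∩ t ⁻¹' Set.Icc (s 0 : ℝ) (s k)) ∩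
          (D ∩ t ⁻¹' Set.Icc (s k : ℝ) (s (k + 1))) = D ∩ t ⁻¹' {(s k : ℝ)} := by
        rw [← Set.inter_inter_distrib_left, ← Set.preimage_inter,
          Set.Icc_inter_Icc_eq_singleton h0k hk1]
      rw [hun]
      rcases (D ∩ t ⁻¹' Set.Icc (s 0 : ℝ) (s k)).eq_empty_or_nonempty with he1 | hn1
      · rw [he1, Set.empty_union]; exact slab k
      rcases (D ∩ t ⁻¹' Set.Icc (s k : ℝ) (s (k + 1))).eq_empty_or_nonempty with he2 | hn2
      · rw [he2, Set.union_empty]; exact ih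
      right
      refine Bounds.union (hD.isClosed.inter (isClosed_Icc.preimage ht))
        (hD.isClosed.inter (isClosed_Icc.preimage ht)) hn1 hn2
        (ih.resolve_left hn1.ne_empty) ((slab k).resolve_left hn2.ne_empty) ?_
      intro A' hA' hd
      rw [hin] at hd ⊢
      refine H _ _ A' hA' ?_ hd
      obtain ⟨x, hx, hxt⟩ := hn1
      obtain ⟨y, hy, hyt⟩ := hn2
      obtain ⟨z, hz, hzt⟩ := hconn x hx y hy (s k) hxt.2 hyt.1
      exact ⟨z, hz, hzt⟩
  have hfull : D ∩ t ⁻¹' Set.Icc (s 0 : ℝ) (s N) = D := by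
    rw [Set.inter_eq_left]
    intro x hx
    have h0 : (s 0 : ℝ) = 0 := by rw [hs0]
    have h1 : (s N : ℝ) = 1 := by rw [hN N le_rfl]
    simpa [h0, h1] using ht01 x hx
  have := all N
  rw [hfull] at this
  exact this.resolve_left hne.ne_empty

end Bounding

section Sphere

variable {K : Type} [Field K] {d : ℕ}

lemma bounds_point {X : Type} [MetricSpace X]
    (h : X ≃ₜ Metric.sphere (0 : EuclideanSpace ℝ (Fin d)) 1) (n : ℕ) {A : Set X}
    (hA : IsCompact A) {p : X} (hp : p ∉ A) : Bounds K n A {p} := by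
  have hv : ‖(h p : EuclideanSpace ℝ (Fin d))‖ = 1 := by simp
  have hvp : (⟨(h p : EuclideanSpace ℝ (Fin d)), by simp⟩ :
      Metric.sphere (0 : EuclideanSpace ℝ (Fin d)) 1) = h p := rfl
  have hsrc : ∀ x, x ≠ p → h x ∈ (stereographic hv).source := fun x hx => by
    rw [stereographic_source]
    exact fun he => hx (h.injective he)
  refine Bounds.of_disjoint_compl_point (φ := fun x => stereographic hv (h x))
    (ψ := fun y => h.symm ((stereographic hv).symm y)) ?_ ?_ ?_ ?_ n hA hp
  · exact (stereographic hv).continuousOn.comp h.continuous.continuousOn hsrc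
  · refine h.symm.continuous.comp ?_
    have := (stereographic hv).continuousOn_symm
    rwa [stereographic_target, ← continuousOn_univ.symm] at this
  · intro y hy
    have h1 : (stereographic hv).symm y ∈ (stereographic hv).source :=
      (stereographic hv).map_target (by simp)
    rw [stereographic_source] at h1
    apply h1
    rw [Set.mem_singleton_iff, hvp]
    exact (h.apply_symm_apply _).symm.trans (congrArg h hy)
  · intro x hx
    rw [(stereographic hv).left_inv (hsrc x hx), h.symm_apply_apply]

lemma bounds_convex {V : Type} [Fintype V] {X : Set (V → ℝ)}
    (hX : ∀ x ∈ X, ∀ v, x v ∈ Set.Icc (0 : ℝ) 1)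
    (hpt : ∀ n (A : Set X) p, IsCompact A → p ∉ A → Bounds K n A {p}) (T : Finset V) :
    ∀ D : Set (V → ℝ), D ⊆ X → Convex ℝ D → IsCompact D → D.Nonempty →
      (∀ v ∉ T, ∀ x ∈ D, ∀ y ∈ D, x v = y v) → ∀ n (A : Set X), IsCompact A →
      Disjoint A (Subtype.val ⁻¹' D) → Bounds K n A (Subtype.val ⁻¹' D) := by
  classical
  induction T using Finset.induction with
  | empty =>
    intro D hDX _ _ hne hc n A hA hd
    obtain ⟨p, hp⟩ := hne
    have : (Subtype.val ⁻¹' D : Set X) = {⟨p, hDX hp⟩} := by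
      ext x
      constructor
      · exact fun hx => Subtype.ext (funext fun v => hc v (by simp) _ hx _ hp)
      · rintro rfl; exact hp
    rw [this] at hd ⊢
    exact hpt n A _ hA (Set.disjoint_singleton_right.mp hd)
  | insert v T _ ih =>
    intro D hDX hconv hD hne hc n A hA hd
    have hDc : IsCompact (Subtype.val ⁻¹' D : Set X) := by
      rw [Subtype.isCompact_iff, Subtype.image_preimage_coe, Set.inter_eq_right.mpr hDX]
      exact hD
    refine Bounds.of_slices (t := fun x : X => x.1 v) hDc ?_
      ((continuous_apply v).comp continuous_subtype_val)
      (fun x _ => hX x.1 x.2 v) ?_ hA hd ?_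
    · obtain ⟨p, hp⟩ := hne
      exact ⟨⟨p, hDX hp⟩, hp⟩
    · intro x hx y hy r hxr hry
      have hpre := hconv.isPreconnected.image (fun z : V → ℝ => z v) (by fun_prop)
      obtain ⟨z, hz, hzr⟩ := hpre.Icc_subset ⟨_, hx, rfl⟩ ⟨_, hy, rfl⟩ ⟨hxr, hry⟩
      exact ⟨⟨z, hDX hz⟩, hz, hzr⟩
    · intro m r A' hA' hn hd'
      have hcl : IsClosed {x : V → ℝ | x v = r} :=
        isClosed_eq (continuous_apply v) continuous_const
      refine ih (D ∩ {x | x v = r}) (Set.inter_subset_left.trans hDX) (hconv.inter ?_)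
        (hD.inter_right hcl) ?_ ?_ m A' hA' hd'
      · exact convex_hyperplane (f := fun x : V → ℝ => x v) ⟨fun _ _ => rfl, fun _ _ => rfl⟩ r
      · obtain ⟨x, hx⟩ := hn
        exact ⟨x.1, hx⟩
      · intro w hw x hx y hy
        by_cases hwv : w = v
        · subst hwv
          exact hx.2.trans hy.2.symm
        · exact hc w (by simp [hwv, hw]) x hx.1 y hy.1

lemma exists_sphere_avoiding (s : Finset (Submodule ℝ (EuclideanSpace ℝ (Fin d))))
    (hs : ∀ W ∈ s, W ≠ ⊤) (hd : 0 < d) :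
    ∃ p : Metric.sphere (0 : EuclideanSpace ℝ (Fin d)) 1, ∀ W ∈ s, p.1 ∉ W := by
  classical
  have hbot : (⊥ : Submodule ℝ (EuclideanSpace ℝ (Fin d))) ≠ ⊤ := by
    have : Nonempty (Fin d) := ⟨⟨0, hd⟩⟩
    exact bot_ne_top
  have hne := Subspace.biUnion_ne_univ_of_top_notMem (s := insert ⊥ s) (by
    simp only [Finset.mem_insert, not_or]
    exact ⟨hbot.symm, fun h => hs _ h rfl⟩)
  obtain ⟨x, hx⟩ := (Set.ne_univ_iff_exists_notMem _).mp hne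
  simp only [Finset.mem_insert, Set.iUnion_iUnion_eq_or_left, Set.mem_union, Set.mem_iUnion,
    not_or, not_exists] at hx
  have hx0 : x ≠ 0 := fun h => hx.1 (by simp [h])
  refine ⟨⟨‖x‖⁻¹ • x, by simp [norm_smul, hx0]⟩, fun W hW h => hx.2 W hW ?_⟩
  exact (W.smul_mem_iff (inv_ne_zero (norm_ne_zero_iff.mpr hx0))).mp h

/-- Below the top dimension, fine cycles on a sphere bound fine chains. -/
lemma sphere_bounds {n : ℕ} (hn : n < d) {ε' : ℝ} (hε' : 0 < ε') :
    ∃ ε > 0, ∀ c ∈ On K (smalls n ε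
        (Set.univ : Set (Metric.sphere (0 : EuclideanSpace ℝ (Fin d)) 1))),
      bd c = 0 → ∃ b ∈ On K (smalls (n + 1) ε' Set.univ), bd b = c := by
  classical
  have hd : 0 < d := by omega
  obtain ⟨q⟩ : Nonempty (Metric.sphere (0 : EuclideanSpace ℝ (Fin d)) 1) :=
    ⟨(exists_sphere_avoiding ∅ (by simp) hd).choose⟩
  have hnorm : ∀ x : EuclideanSpace ℝ (Fin d), x ≠ 0 → ‖x‖⁻¹ • x ∈
      Metric.sphere (0 : EuclideanSpace ℝ (Fin d)) 1 := fun x hx => by simp [norm_smul, hx]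
  let E := EuclideanSpace ℝ (Fin d)
  let S := Metric.sphere (0 : E) 1
  let ν : E → S := fun x => if hx : x = 0 then q else ⟨‖x‖⁻¹ • x, hnorm x hx⟩
  have hν1 : ∀ x : E, x ≠ 0 → (ν x : E) = ‖x‖⁻¹ • x := fun x hx => by simp [ν, hx]
  have hνS : ∀ x : S, ν x = x := fun x => by
    have hx : ‖(x : E)‖ = 1 := by simp
    have hx0 : (x : E) ≠ 0 := fun h => by rw [h] at hx; simp at hx
    apply Subtype.ext
    rw [hν1 _ hx0, hx]; simp
  let C : Set E := Metric.closedBall 0 2 ∩ {x | 1 / 2 ≤ ‖x‖}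
  have hC0 : ∀ x ∈ C, x ≠ 0 := fun x hx h => by
    have h2 : 1 / 2 ≤ ‖x‖ := hx.2
    rw [h, norm_zero] at h2
    norm_num at h2
  have hC : IsCompact C := (isCompact_closedBall _ _).inter_right
    (isClosed_le continuous_const continuous_norm)
  have hνC : ContinuousOn ν C := by
    rw [Topology.IsInducing.subtypeVal.continuousOn_iff]
    refine ContinuousOn.congr (f := fun x : E => ‖x‖⁻¹ • x) ?_ (fun x hx => hν1 x (hC0 x hx))
    exact (continuous_norm.continuousOn.inv₀ fun x hx =>
      norm_ne_zero_iff.mpr (hC0 x hx)).smul continuousOn_id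
  have hunif := Metric.uniformContinuousOn_iff.mp (hC.uniformContinuousOn_of_continuous hνC)
  obtain ⟨ε₀, hε₀, h0⟩ := hunif ε' hε'
  refine ⟨min ε₀ (1 / 2), lt_min hε₀ (by norm_num), fun c hc hb => ?_⟩
  have hlen : ∀ l ∈ c.support, l ∈ smalls n (min ε₀ (1 / 2)) Set.univ := fun l hl =>
    (Finsupp.mem_supported K c).mp hc hl
  have hcs : c ∈ On K (c.support : Set (List S)) := (Finsupp.mem_supported K c).mpr subset_rfl
  let U : List S → Set E := fun l => convexHull ℝ {x | x ∈ l.map Subtype.val}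
  let span : List S → Submodule ℝ E := fun l => Submodule.span ℝ {x | x ∈ l.map Subtype.val}
  have hUspan : ∀ l, U l ⊆ span l := fun l =>
    convexHull_min Submodule.subset_span (span l).convex
  have hUdist : ∀ l ∈ c.support, ∀ x ∈ U l, ∀ y ∈ U l, dist x y < min ε₀ (1 / 2) := by
    intro l hl x hx y hy
    obtain ⟨x', hx', y', hy', hle⟩ := convexHull_exists_dist_ge2 hx hy
    simp only [List.mem_map, Set.mem_ofPred_eq] at hx' hy'
    obtain ⟨x'', hx'', rfl⟩ := hx'
    obtain ⟨y'', hy'', rfl⟩ := hy'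
    exact hle.trans_lt ((hlen l hl).2.2 _ hx'' _ hy'')
  have hUC : ∀ l ∈ c.support, U l ⊆ C := by
    intro l hl x hx
    obtain ⟨a, ha⟩ : {x | x ∈ l.map Subtype.val}.Nonempty := convexHull_nonempty_iff.mp ⟨x, hx⟩
    have hax := hUdist l hl a (subset_convexHull ℝ _ ha) x hx
    obtain ⟨a', _, rfl⟩ := List.mem_map.mp ha
    have ha1 : ‖(a' : E)‖ = 1 := by simp
    have h1 : dist (a' : E) x < 1 / 2 := hax.trans_le (min_le_right _ _)
    rw [dist_eq_norm] at h1
    have h2 := norm_sub_norm_le (a' : E) x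
    have h3 := norm_sub_norm_le x (a' : E)
    rw [norm_sub_rev] at h3
    refine ⟨?_, ?_⟩
    · rw [mem_closedBall_zero_iff]; linarith
    · change 1 / 2 ≤ ‖x‖; linarith
  obtain ⟨p, hp⟩ := exists_sphere_avoiding (c.support.image span) (by
    simp only [Finset.mem_image]
    rintro _ ⟨l, hl, rfl⟩ htop
    have h1 : Module.finrank ℝ (span l) ≤ l.length := by
      have h2 := finrank_span_finset_le_card (R := ℝ) (l.map (Subtype.val : S → E)).toFinset
      have h3 := List.toFinset_card_le (l.map (Subtype.val : S → E))
      rw [List.length_map] at h3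
      have h4 : ((l.map (Subtype.val : S → E)).toFinset : Set E) =
          {x | x ∈ l.map Subtype.val} := by ext; simp
      rw [h4] at h2
      exact h2.trans h3
    rw [htop, finrank_top, finrank_euclideanSpace_fin, (hlen l hl).1] at h1
    omega) hd
  let A : Set S := ⋃ l ∈ c.support, {x | (x : E) ∈ span l}
  have hA : IsCompact A := by
    refine c.support.finite_toSet.isCompact_biUnion fun l _ => IsClosed.isCompact ?_
    exact (span l).closed_of_finiteDimensional.preimage continuous_subtype_val
  have hpA : p ∉ A := by
    simp only [A, Set.mem_iUnion, not_exists]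
    exact fun l hl h => hp _ (Finset.mem_image_of_mem _ hl) h
  obtain ⟨B, -, -, HB⟩ := bounds_point (K := K) (Homeomorph.refl S) n hA hpA
  obtain ⟨δ, hδ, HB⟩ := HB ε' hε'
  obtain ⟨δ₁, hδ₁, h1⟩ := hunif δ hδ
  obtain ⟨s, hs0, hsl, hsb⟩ := exists_subdivision K E hδ₁
  have hUmem : ∀ l : List S, ∀ x ∈ l.map Subtype.val, x ∈ U l := fun l x hx =>
    subset_convexHull ℝ _ hx
  obtain ⟨T, hT, hTb⟩ := exists_homotopy (K := K) (s ∘ₗ push (Subtype.val : S → E))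
    (push Subtype.val) (fun c => by simp [hsb, bd_push]) (bd_push _) (by simp [hs0]) U
    (fun l' l h => convexHull_mono fun x hx => (h.map _).subset hx)
    (fun l hl => by
      obtain ⟨a, ha⟩ := List.exists_mem_of_ne_nil l hl
      exact ⟨a, hUmem l a (List.mem_map_of_mem ha)⟩)
    (fun l => by
      have := hsl (l.map Subtype.val)
      rw [List.length_map] at this
      rw [LinearMap.comp_apply, push_single]
      exact On_mono (R := lists l.length (U l)) (fun m hm => ⟨hm.1, hm.2.1⟩) this)
    (fun l => by
      rw [push_single]
      exact single_mem (Q := lists l.length (U l)) ⟨by simp, hUmem l⟩ 1)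
  have hνc : push ν (push (Subtype.val : S → E) c) = c := by
    rw [push_push]
    exact push_eq_self _ (fun l _ x _ => hνS x) hcs
  have hνT : push ν (T c) ∈ On K (smalls (n + 1) ε' (Set.univ : Set S)) := by
    refine map_mem (push ν ∘ₗ T) (fun l hl => ?_) hcs
    rw [LinearMap.comp_apply]
    refine push_smalls (S := U l) (ε := ε₀) (fun _ _ => Set.mem_univ _)
      (fun x hx y hy h => h0 x (hUC l hl hx) y (hUC l hl hy) h)
      (On_mono (fun m hm => ?_) (hT l))
    exact ⟨by rw [hm.1, (hlen l hl).1], hm.2, fun x hx y hy =>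
      (hUdist l hl x (hm.2 x hx) y (hm.2 y hy)).trans_le (min_le_left _ _)⟩
  have hνs : push ν (s (push (Subtype.val : S → E) c)) ∈ On K (smalls n δ A) := by
    refine map_mem (push ν ∘ₗ s ∘ₗ push (Subtype.val : S → E)) (fun l hl => ?_) hcs
    rw [LinearMap.comp_apply, LinearMap.comp_apply, push_single]
    have h3 := hsl (l.map Subtype.val)
    rw [List.length_map, (hlen l hl).1] at h3
    refine push_smalls (fun x hx => ?_)
      (fun x hx y hy h => h1 x (hUC l hl hx) y (hUC l hl hy) h) h3
    refine Set.mem_biUnion hl ?_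
    change (ν x : E) ∈ span l
    rw [hν1 x (hC0 x (hUC l hl hx))]
    exact (span l).smul_mem _ (hUspan l hx)
  obtain ⟨b, hbm, hbb⟩ := HB _ hνs (by rw [bd_push, hsb, bd_push, hb, map_zero, map_zero, map_zero])
  refine ⟨b - push ν (T c), Submodule.sub_mem _
    (On_mono (smalls_mono le_rfl (Set.subset_univ _)) hbm) hνT, ?_⟩
  rw [map_sub, hbb, bd_push, hTb c hb, map_sub, hνc, LinearMap.comp_apply]
  abel

lemma bounds_empty {X : Type} [MetricSpace X]
    (h : X ≃ₜ Metric.sphere (0 : EuclideanSpace ℝ (Fin d)) 1) {n : ℕ} (hn : n < d) (A : Set X) :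
    Bounds K n A ∅ := by
  have : CompactSpace X := h.symm.compactSpace
  refine ⟨Set.univ, isCompact_univ, by simp, fun ε' hε' => ?_⟩
  obtain ⟨δ, hδ, h1⟩ := Metric.uniformContinuous_iff.mp
    (CompactSpace.uniformContinuous_of_continuous h.symm.continuous) ε' hε'
  obtain ⟨δ', hδ', h2⟩ := sphere_bounds (K := K) hn hδ
  obtain ⟨ε, hε, h3⟩ := Metric.uniformContinuous_iff.mp
    (CompactSpace.uniformContinuous_of_continuous h.continuous) δ' hδ'
  refine ⟨ε, hε, fun c hc hb => ?_⟩
  obtain ⟨b, hbm, hbb⟩ := h2 (push h c)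
    (push_smalls (fun _ _ => Set.mem_univ _) (fun x _ y _ hxy => h3 hxy) hc)
    (by rw [bd_push, hb, map_zero])
  refine ⟨push h.symm b, push_smalls (fun _ _ => Set.mem_univ _)
    (fun x _ y _ hxy => h1 hxy) hbm, ?_⟩
  rw [bd_push, hbb, push_push]
  exact push_eq_self _ (fun l _ x _ => h.symm_apply_apply x) hc

end Sphere

section ToOriented

variable {V : Type}

/-- Simplicial chains of `Γ` as oriented chains on all vertices. -/
noncomputable def toOriented (K : Type) [Field K] (Γ : ASC V) (j : ℤ) :
    ASC.Chains K Γ j →ₗ[K] (Finset V →₀ K) :=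
  (Finsupp.lmapDomain K K Subtype.val : (ASC.Cells Γ j →₀ K) →ₗ[K] (Finset V →₀ K))

lemma toOriented_single {K : Type} [Field K] {Γ : ASC V} {j : ℤ}
    (σ : ASC.Cells Γ j) (k : K) :
    toOriented K Γ j (Finsupp.single σ k : ASC.Cells Γ j →₀ K) = Finsupp.single σ.1 k :=
  Finsupp.mapDomain_single

lemma toOriented_injective (K : Type) [Field K] (Γ : ASC V) (j : ℤ) :
    Function.Injective (toOriented K Γ j) :=
  Finsupp.mapDomain_injective Subtype.val_injective

end ToOriented

section Oriented

variable {K : Type} [Field K] {V : Type} [LinearOrder V]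

/-- The sign with which the vertex `a` enters the boundary of `σ`. -/
def sgn (K : Type) [Field K] (a : V) (σ : Finset V) : K :=
  (-1) ^ (σ.filter (fun w => w < a)).card

/-- Left exterior multiplication by the vertex `a` on oriented chains. -/
noncomputable def wedge (a : V) : (Finset V →₀ K) →ₗ[K] (Finset V →₀ K) :=
  Finsupp.linearCombination K fun σ =>
    if a ∈ σ then 0 else Finsupp.single (insert a σ) (sgn K a σ)

/-- The boundary operator on oriented chains. -/
noncomputable def orientedBd : (Finset V →₀ K) →ₗ[K] (Finset V →₀ K) :=
  Finsupp.linearCombination K fun σ => ∑ v ∈ σ, Finsupp.single (σ.erase v) (sgn K v σ)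

lemma wedge_single (a : V) (σ : Finset V) (k : K) : wedge a (Finsupp.single σ k) =
    if a ∈ σ then 0 else Finsupp.single (insert a σ) (k * sgn K a σ) := by
  simp [wedge]

lemma orientedBd_single (σ : Finset V) (k : K) : orientedBd (Finsupp.single σ k) =
    ∑ v ∈ σ, Finsupp.single (σ.erase v) (k * sgn K v σ) := by
  simp [orientedBd, Finset.smul_sum]

lemma sgn_mul_self (a : V) (σ : Finset V) : sgn K a σ * sgn K a σ = 1 := by
  rw [sgn, ← mul_pow]; simp

lemma sgn_insert_of_lt {a v : V} {σ : Finset V} (ha : a ∉ σ) (h : a < v) :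
    sgn K v (insert a σ) = -sgn K v σ := by
  rw [sgn, Finset.filter_insert, if_pos h, Finset.card_insert_of_notMem (by simp [ha]), pow_succ,
    sgn]
  ring

lemma sgn_insert_of_le {a v : V} {σ : Finset V} (h : v ≤ a) :
    sgn K v (insert a σ) = sgn K v σ := by
  rw [sgn, Finset.filter_insert, if_neg h.not_gt, sgn]

lemma sgn_insert_mul_sgn {a v : V} {σ : Finset V} (ha : a ∉ σ) (hv : v ∈ σ) :
    sgn K a σ * sgn K v (insert a σ) = -(sgn K v σ * sgn K a (σ.erase v)) := by
  have hne : v ≠ a := fun h => ha (h ▸ hv)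
  have hσ := Finset.insert_erase hv
  rcases lt_or_gt_of_ne hne with h | h
  · have h1 : sgn K a σ = -sgn K a (σ.erase v) := by
      conv_lhs => rw [← hσ]
      exact sgn_insert_of_lt (by simp) h
    rw [sgn_insert_of_le h.le, h1]; ring
  · have h1 : sgn K a σ = sgn K a (σ.erase v) := by
      conv_lhs => rw [← hσ]
      exact sgn_insert_of_le h.le
    rw [sgn_insert_of_lt ha h, h1]; ring

lemma orientedBd_wedge (a : V) (x : Finset V →₀ K) :
    orientedBd (wedge a x) = x - wedge a (orientedBd x) := by
  have : orientedBd ∘ₗ wedge a =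
      LinearMap.id - wedge a ∘ₗ (orientedBd : (Finset V →₀ K) →ₗ[K] _) := by
    ext1 σ; ext1
    simp only [LinearMap.comp_apply, Finsupp.lsingle_apply, LinearMap.sub_apply,
      LinearMap.id_apply, orientedBd_single, one_mul, map_sum, wedge_single]
    by_cases ha : a ∈ σ
    · rw [if_pos ha, map_zero, Finset.sum_eq_single a]
      · rw [if_neg (by simp), Finset.insert_erase ha]
        have : sgn K a (σ.erase a) = sgn K a σ := by
          conv_rhs => rw [← Finset.insert_erase ha]
          exact (sgn_insert_of_le le_rfl).symm
        rw [this, sgn_mul_self, sub_self]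
      · exact fun v _ hva => if_pos (by simp [ha, hva.symm])
      · exact fun h => absurd ha h
    · rw [if_neg ha, orientedBd_single, Finset.sum_insert ha, Finset.erase_insert ha,
        sgn_insert_of_le le_rfl, sgn_mul_self, sub_eq_add_neg, ← Finset.sum_neg_distrib]
      congr 1
      refine Finset.sum_congr rfl fun v hv => ?_
      have hne : v ≠ a := fun h => ha (h ▸ hv)
      rw [if_neg (by simp [ha]), ← Finsupp.single_neg, sgn_insert_mul_sgn ha hv,
        Finset.erase_insert_of_ne hne.symm]
  exact LinearMap.congr_fun this x

/-- The oriented simplex spanned by an ordered one. -/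
noncomputable def orientList : List V → (Finset V →₀ K)
  | [] => Finsupp.single ∅ 1
  | a :: l => wedge a (orientList l)

/-- The projection of ordered chains onto oriented chains. -/
noncomputable def orient : Chain K V →ₗ[K] (Finset V →₀ K) :=
  Finsupp.linearCombination K orientList

/-- The section of `orient` listing the vertices of a simplex in increasing order. -/
noncomputable def sortChain : (Finset V →₀ K) →ₗ[K] Chain K V :=
  Finsupp.lmapDomain K K fun σ => σ.sort (· ≤ ·)

@[simp] lemma orient_single (l : List V) : orient (Finsupp.single l (1 : K)) = orientList l := by
  simp [orient]

@[simp] lemma sortChain_single (σ : Finset V) (k : K) :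
    sortChain (Finsupp.single σ k) = Finsupp.single (σ.sort (· ≤ ·)) k := by
  simp [sortChain, Finsupp.lmapDomain_apply, Finsupp.mapDomain_single]

lemma orient_cone (a : V) (c : Chain K V) : orient (cone a c) = wedge a (orient c) := by
  have : orient ∘ₗ cone a = wedge a ∘ₗ (orient : Chain K V →ₗ[K] _) := by
    ext1 l; ext1
    simp [orientList]
  exact LinearMap.congr_fun this c

lemma orient_bd (c : Chain K V) : orient (bd c) = orientedBd (orient c) := by
  have : orient ∘ₗ bd = orientedBd ∘ₗ (orient : Chain K V →ₗ[K] _) := by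
    ext1 l; ext1
    simp only [LinearMap.comp_apply, Finsupp.lsingle_apply, bd_single, orient_single]
    induction l with
    | nil => simp [bdList, orientList, orientedBd_single]
    | cons a l ih => simp [bdList, orientList, orient_cone, orientedBd_wedge, ih]
  exact LinearMap.congr_fun this c

lemma wedge_single_of_lt {a : V} {s : Finset V} (h : ∀ b ∈ s, a < b) (k : K) :
    wedge a (Finsupp.single s k) = Finsupp.single (insert a s) k := by
  have ha : a ∉ s := fun hm => lt_irrefl a (h a hm)
  rw [wedge_single, if_neg ha, sgn, Finset.filter_false_of_mem fun b hb => (h b hb).not_gt]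
  simp

lemma sort_insert_of_lt {a : V} {s : Finset V} (h : ∀ b ∈ s, a < b) :
    (insert a s).sort (· ≤ ·) = a :: s.sort (· ≤ ·) :=
  Finset.sort_insert _ (fun b hb => (h b hb).le) fun hm => lt_irrefl a (h a hm)

lemma orient_sortChain (x : Finset V →₀ K) : orient (sortChain x) = x := by
  have : orient ∘ₗ sortChain = (LinearMap.id : (Finset V →₀ K) →ₗ[K] _) := by
    ext1 σ; ext1
    simp only [LinearMap.comp_apply, Finsupp.lsingle_apply, sortChain_single, orient_single,
      LinearMap.id_apply]
    induction σ using Finset.induction_on_min with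
    | empty => simp [orientList]
    | insert a s h ih =>
      rw [sort_insert_of_lt h, orientList, ih, wedge_single_of_lt h]
  exact LinearMap.congr_fun this x

lemma bd_sortChain (x : Finset V →₀ K) : bd (sortChain x) = sortChain (orientedBd x) := by
  have : bd ∘ₗ sortChain = sortChain ∘ₗ (orientedBd : (Finset V →₀ K) →ₗ[K] _) := by
    ext1 σ; ext1
    simp only [LinearMap.comp_apply, Finsupp.lsingle_apply, sortChain_single, bd_single]
    induction σ using Finset.induction_on_min with
    | empty => simp [bdList, orientedBd_single]
    | insert a s h ih =>
      rw [sort_insert_of_lt h, bdList, ih, ← wedge_single_of_lt h, orientedBd_wedge, map_sub,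
        sortChain_single]
      congr 1
      simp only [orientedBd_single, map_sum]
      refine Finset.sum_congr rfl fun v hv => ?_
      have h' : ∀ b ∈ s.erase v, a < b := fun b hb => h b (Finset.mem_of_mem_erase hb)
      rw [wedge_single_of_lt h', sortChain_single, sortChain_single, cone_single,
        sort_insert_of_lt h']
  exact LinearMap.congr_fun this x

lemma orientList_eq (l : List V) : ∃ k : K, orientList l = Finsupp.single l.toFinset k ∧
    (k ≠ 0 → l.toFinset.card = l.length) := by
  induction l with
  | nil => exact ⟨1, by simp [orientList], by simp⟩
  | cons a l ih =>
    obtain ⟨k, hk, hc⟩ := ih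
    by_cases ha : a ∈ l.toFinset
    · exact ⟨0, by rw [orientList, hk, wedge_single, if_pos ha, Finsupp.single_zero], by simp⟩
    · refine ⟨k * sgn K a l.toFinset, ?_, fun h => ?_⟩
      · rw [orientList, hk, wedge_single, if_neg ha, List.toFinset_cons]
      · rw [List.toFinset_cons, Finset.card_insert_of_notMem ha, hc (left_ne_zero_of_mul h),
          List.length_cons]

/-- Ordered simplices on `n` vertices spanning a face of `Γ`. -/
def faceLists (Γ : ASC V) (n : ℕ) : Set (List V) :=
  {l | l.length = n ∧ l.toFinset ∈ Γ.faces}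

lemma toOriented_boundary (Γ : ASC V) (j k : ℤ) (hk : k = j - 1) (x : ASC.Chains K Γ j) :
    toOriented K Γ k (ASC.boundary K Γ j k hk x) = orientedBd (toOriented K Γ j x) := by
  have : toOriented K Γ k ∘ₗ ASC.boundary K Γ j k hk = orientedBd ∘ₗ toOriented K Γ j := by
    refine Finsupp.lhom_ext' (M := K) (α := ASC.Cells Γ j) fun σ => LinearMap.ext_ring ?_
    change toOriented K Γ k (ASC.boundary K Γ j k hk (Finsupp.single σ 1 : ASC.Cells Γ j →₀ K)) =
      orientedBd (toOriented K Γ j (Finsupp.single σ 1 : ASC.Cells Γ j →₀ K))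
    let face (v : {x // x ∈ σ.1}) : ASC.Chains K Γ k :=
      (Finsupp.single ⟨σ.1.erase v.1, Γ.down_closed σ.2.1 (Finset.erase_subset _ _), by
        have := Finset.card_erase_add_one v.2
        have := σ.2.2
        omega⟩ (sgn K v.1 σ.1) : ASC.Cells Γ k →₀ K)
    have hb : ASC.boundary K Γ j k hk (Finsupp.single σ 1 : ASC.Cells Γ j →₀ K) =
        ∑ v ∈ σ.1.attach, face v :=
      (Finsupp.lsum_single (M := K) (N := ASC.Chains K Γ k) K _ σ 1).trans (one_smul K _)
    rw [hb, map_sum, toOriented_single, orientedBd_single,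
      ← Finset.sum_attach σ.1]
    refine Finset.sum_congr rfl fun v _ => ?_
    rw [one_mul]
    exact toOriented_single _ _
  exact LinearMap.congr_fun this x

lemma sortChain_toOriented_mem {Γ : ASC V} {j : ℤ} {n : ℕ} (hj : (n : ℤ) = j + 1)
    (z : ASC.Chains K Γ j) : sortChain (toOriented K Γ j z) ∈ On K (faceLists Γ n) := by
  refine Finsupp.induction_linear (motive := fun z : ASC.Cells Γ j →₀ K =>
    sortChain (toOriented K Γ j z) ∈ On K (faceLists Γ n)) z ?_ ?_ ?_
  · exact Submodule.zero_mem _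
  · intro x y hx hy
    have := Submodule.add_mem _ hx hy
    have e := map_add (sortChain ∘ₗ toOriented K Γ j) (x : ASC.Chains K Γ j) y
    exact e ▸ this
  · intro σ k
    rw [toOriented_single, sortChain_single]
    refine single_mem (Q := faceLists Γ n) ⟨?_, ?_⟩ k
    · have := σ.2.2
      rw [Finset.length_sort]; omega
    · rw [Finset.sort_toFinset]; exact σ.2.1

lemma orient_mem_range {Γ : ASC V} {j : ℤ} {n : ℕ} (hj : (n : ℤ) = j + 1) {c : Chain K V}
    (hc : c ∈ On K (faceLists Γ n)) : orient c ∈ LinearMap.range (toOriented K Γ j) := by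
  refine map_mem _ (fun l hl => ?_) hc
  rw [orient_single]
  obtain ⟨k, hk, hcard⟩ := orientList_eq (K := K) l
  rw [hk]
  by_cases h : k = 0
  · rw [h, Finsupp.single_zero]; exact Submodule.zero_mem _
  · exact ⟨_, toOriented_single ⟨l.toFinset, hl.2, by rw [hcard h, hl.1]; omega⟩ k⟩

/-- Vanishing of reduced homology can be tested on ordered chains. -/
lemma subsingleton_reducedHomology {Γ : ASC V} {j : ℤ} {n : ℕ} (hj : (n : ℤ) = j + 1)
    (h : ∀ z ∈ On K (faceLists Γ n), bd z = 0 → ∃ c ∈ On K (faceLists Γ (n + 1)), bd c = z) :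
    Subsingleton (ASC.reducedHomology K Γ j) := by
  rw [Submodule.Quotient.subsingleton_iff, eq_top_iff]
  rintro ⟨z, hz⟩ -
  rw [Submodule.mem_comap]
  obtain ⟨c, hc, hbc⟩ := h _ (sortChain_toOriented_mem hj z) (by
    rw [bd_sortChain, ← toOriented_boundary Γ j (j - 1) rfl, LinearMap.mem_ker.mp hz, map_zero,
      map_zero])
  obtain ⟨y, hy⟩ := orient_mem_range (j := j + 1) (by push_cast; omega) hc
  refine ⟨y, toOriented_injective K Γ j ?_⟩
  rw [toOriented_boundary, hy, ← orient_bd, hbc, orient_sortChain]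
  rfl

end Oriented

section Realization

variable {V : Type}

lemma isClosed_supported (s : Set V) : IsClosed {x : V → ℝ | ∀ v ∉ s, x v = 0} := by
  simp only [Set.ofPred_forall]
  exact isClosed_iInter fun v => isClosed_iInter fun _ =>
    isClosed_eq (continuous_apply v) continuous_const

variable [Fintype V]

/-- The points of the standard simplex supported on `s`. -/
def simplexOn (s : Set V) : Set (V → ℝ) :=
  stdSimplex ℝ V ∩ {x | ∀ v ∉ s, x v = 0}

lemma convex_simplexOn (s : Set V) : Convex ℝ (simplexOn s) := by
  refine (convex_stdSimplex ℝ V).inter fun x hx y hy a b _ _ _ v hv => ?_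
  simp [hx v hv, hy v hv]

lemma isCompact_simplexOn (s : Set V) : IsCompact (simplexOn s) :=
  (isCompact_stdSimplex ℝ V).inter_right (isClosed_supported s)

lemma single_mem_simplexOn [DecidableEq V] {s : Set V} {v : V} (hv : v ∈ s) :
    Pi.single v (1 : ℝ) ∈ simplexOn s :=
  ⟨single_mem_stdSimplex ℝ v, fun w hw => Pi.single_eq_of_ne (fun h : w = v => hw (h ▸ hv)) 1⟩

lemma convexHull_subset_simplexOn [DecidableEq V] (l : List V) :
    convexHull ℝ {y | y ∈ l.map fun v => Pi.single v (1 : ℝ)} ⊆ simplexOn {v | v ∈ l} := by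
  refine convexHull_min (fun y hy => ?_) (convex_simplexOn _)
  obtain ⟨v, hv, rfl⟩ := List.mem_map.mp hy
  exact single_mem_simplexOn hv

lemma mem_realization {P : ASC V} {σ : Finset V} (hσ : σ ∈ P.faces) {x : V → ℝ}
    (hx : x ∈ stdSimplex ℝ V) (h : ∀ v, x v ≠ 0 → v ∈ σ) : x ∈ P.realization := by
  classical
  exact ⟨hx.1, hx.2, univ.filter (x · ≠ 0), P.down_closed hσ fun v hv => h v (by simpa using hv),
    by simp⟩

lemma realization_subset_stdSimplex (P : ASC V) : P.realization ⊆ stdSimplex ℝ V :=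
  fun _ hx => ⟨hx.1, hx.2.1⟩

lemma simplexOn_subset_realization {P : ASC V} {σ : Finset V} (hσ : σ ∈ P.faces) :
    simplexOn (σ : Set V) ⊆ P.realization := fun x hx =>
  mem_realization hσ hx.1 fun v hv => by
    by_contra h
    exact hv (hx.2 v (by simpa using h))

lemma mem_simplexOn_of_sum {s : Finset V} [DecidableEq V] {x : V → ℝ} (hx : x ∈ stdSimplex ℝ V)
    (h : ∑ v ∈ sᶜ, x v = 0) : x ∈ simplexOn (s : Set V) := by
  rw [Finset.sum_eq_zero_iff_of_nonneg fun v _ => hx.1 v] at h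
  exact ⟨hx, fun v hv => h v (by simpa using hv)⟩

/-- A compact set missing a coordinate face stays uniformly away from it. -/
lemma exists_pos_le_coord {X : Set (V → ℝ)} (hX : X ⊆ stdSimplex ℝ V) (I : Finset V) {B : Set X}
    (hB : IsCompact B) (hd : Disjoint B (Subtype.val ⁻¹' simplexOn (I : Set V))) :
    ∃ η > 0, ∀ x ∈ B, ∃ v ∉ I, η ≤ x.1 v := by
  classical
  rcases B.eq_empty_or_nonempty with rfl | hne
  · exact ⟨1, one_pos, by simp⟩
  obtain ⟨x, hx, hmin⟩ := hB.exists_isMinOn hne (f := fun x : X => ∑ v ∈ Iᶜ, x.1 v)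
    (by fun_prop)
  have hpos : 0 < ∑ v ∈ Iᶜ, x.1 v := by
    refine (Finset.sum_nonneg fun v _ => (hX x.2).1 v).lt_of_ne fun h => ?_
    exact Set.disjoint_left.mp hd hx (mem_simplexOn_of_sum (hX x.2) h.symm)
  have hcard : (0 : ℝ) < (Iᶜ).card := by
    rw [Nat.cast_pos, Finset.card_pos, Finset.nonempty_iff_ne_empty]
    rintro h
    simp [h] at hpos
  refine ⟨(∑ v ∈ Iᶜ, x.1 v) / (Iᶜ).card, by positivity, fun y hy => ?_⟩
  by_contra! h
  have h1 : ∑ v ∈ Iᶜ, y.1 v < ∑ v ∈ Iᶜ, (∑ v ∈ Iᶜ, x.1 v) / (Iᶜ).card :=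
    Finset.sum_lt_sum_of_nonempty (Finset.card_pos.mp (by exact_mod_cast hcard))
      fun v hv => h v (by simpa using hv)
  rw [Finset.sum_const, nsmul_eq_mul, mul_div_cancel₀ _ hcard.ne'] at h1
  exact h1.not_ge (hmin hy)

lemma exists_vertex_selection [Nonempty V] (I : Finset V) {η : ℝ} (hη : 0 < η) :
    ∃ r : (V → ℝ) → V, ∀ x, ((∃ v, x v ≠ 0) → x (r x) ≠ 0) ∧
      ((∃ v ∉ I, η ≤ x v) → r x ∉ I ∧ η ≤ x (r x)) := by
  refine ⟨_, fun x => Classical.choose_spec (p := fun v => ((∃ v, x v ≠ 0) → x v ≠ 0) ∧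
      ((∃ v ∉ I, η ≤ x v) → v ∉ I ∧ η ≤ x v)) ?_⟩
  by_cases h : ∃ v ∉ I, η ≤ x v
  · obtain ⟨v, hv⟩ := h
    exact ⟨v, fun _ => (hη.trans_le hv.2).ne', fun _ => hv⟩
  by_cases h' : ∃ v, x v ≠ 0
  · exact ⟨h'.choose, fun _ => h'.choose_spec, fun h'' => absurd h'' h⟩
  · exact ⟨Classical.arbitrary V, fun h'' => absurd h'' h', fun h'' => absurd h'' h⟩

lemma bounds_face {K : Type} [Field K] {d n : ℕ} {P : ASC V}
    (h : P.realization ≃ₜ Metric.sphere (0 : EuclideanSpace ℝ (Fin d)) 1) {I : Finset V}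
    (hI : I ∈ P.faces) (hn : n < d) {A : Set P.realization} (hA : IsCompact A)
    (hd : Disjoint A (Subtype.val ⁻¹' simplexOn (I : Set V))) :
    Bounds K n A (Subtype.val ⁻¹' simplexOn (I : Set V)) := by
  classical
  rcases I.eq_empty_or_nonempty with rfl | ⟨v, hv⟩
  · have : simplexOn ((∅ : Finset V) : Set V) = ∅ := by
      refine Set.eq_empty_of_forall_notMem fun x hx => ?_
      have := hx.1.2
      rw [Finset.sum_eq_zero fun v _ => hx.2 v (by simp)] at this
      exact zero_ne_one this
    rw [this, Set.preimage_empty]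
    exact bounds_empty h hn A
  · exact bounds_convex
      (fun x hx v => mem_Icc_of_mem_stdSimplex (realization_subset_stdSimplex P hx) v)
      (fun m A' p hA' hp => bounds_point h m hA' hp) Finset.univ _
      (simplexOn_subset_realization hI) (convex_simplexOn _) (isCompact_simplexOn _)
      ⟨_, single_mem_simplexOn (s := (I : Set V)) hv⟩ (fun v hv => by simp at hv) n A hA hd

end Realization

section Acyclic

variable {K : Type} [Field K] {V : Type} [Fintype V] [LinearOrder V]

lemma restrict_compl_acyclic {d n : ℕ} {P : ASC V}
    (h : P.realization ≃ₜ Metric.sphere (0 : EuclideanSpace ℝ (Fin d)) 1) {I : Finset V}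
    (hI : I ∈ P.faces) (hn : n < d) {z : Chain K V}
    (hz : z ∈ On K (faceLists (P.restrict Iᶜ) n)) (hbz : bd z = 0) :
    ∃ c ∈ On K (faceLists (P.restrict Iᶜ) (n + 1)), bd c = z := by
  have hcpt : CompactSpace P.realization := h.symm.compactSpace
  obtain ⟨p, -⟩ := exists_sphere_avoiding (d := d) ∅ (by simp) (by omega)
  let x₀ : P.realization := h.symm p
  have hsupp : ∀ x ∈ stdSimplex ℝ V, ∃ v, x v ≠ 0 := by
    intro x hx
    by_contra! h0
    have := hx.2
    simp [h0] at this
  have hV : Nonempty V := ⟨(hsupp x₀ (realization_subset_stdSimplex P x₀.2)).choose⟩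
  let A : Set P.realization := Subtype.val ⁻¹' {x | ∀ v ∉ (I : Set V)ᶜ, x v = 0}
  have hA : IsCompact A := ((isClosed_supported _).preimage continuous_subtype_val).isCompact
  have hAD : Disjoint A (Subtype.val ⁻¹' simplexOn (I : Set V)) := by
    rw [Set.disjoint_left]
    rintro x hxA hxD
    obtain ⟨v, hv⟩ := hsupp x hxD.1
    by_cases hvI : v ∈ I
    · exact hv (hxA v (by simpa using hvI))
    · exact hv (hxD.2 v (by simpa using hvI))
  obtain ⟨B, hB, hBD, hbound⟩ := bounds_face (K := K) h hI hn hA hAD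
  obtain ⟨η, hη, hηB⟩ := exists_pos_le_coord (realization_subset_stdSimplex P) I hB hBD
  obtain ⟨r, hr⟩ := exists_vertex_selection I hη
  obtain ⟨ε, hε, hbound⟩ := hbound η hη
  obtain ⟨s, hs0, hsl, hbs⟩ := exists_subdivision K (V → ℝ) hε
  let e : V → V → ℝ := fun v => Pi.single v 1
  have hsz : s (push e z) ∈ On K (smalls n ε {x | x ∈ P.realization ∧
      ∀ v ∉ (I : Set V)ᶜ, x v = 0}) := by
    refine map_mem (s ∘ₗ push e) (fun l hl => ?_) hz
    rw [LinearMap.comp_apply, push_single]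
    refine On_mono ?_ (hsl (l.map e))
    rw [List.length_map, hl.1]
    refine smalls_mono le_rfl fun x hx => ?_
    have hx' := convexHull_subset_simplexOn l hx
    refine ⟨simplexOn_subset_realization hl.2.1 (by simpa using hx'), fun v hv => hx'.2 v ?_⟩
    intro hvl
    have := hl.2.2 (List.mem_toFinset.mpr hvl)
    simp at this hv
    exact this hv
  let ρ : (V → ℝ) → P.realization := fun x =>
    open Classical in if hx : x ∈ P.realization then ⟨x, hx⟩ else x₀
  have hρ : ∀ x ∈ P.realization, (ρ x : V → ℝ) = x := fun x hx => by simp [ρ, hx]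
  have hc₁ : push ρ (s (push e z)) ∈ On K (smalls n ε A) := by
    refine push_smalls (fun x hx => ?_) (fun x hx y hy hxy => ?_) hsz
    · change ∀ v ∉ (I : Set V)ᶜ, (ρ x : V → ℝ) v = 0
      rw [hρ x hx.1]
      exact hx.2
    · rwa [Subtype.dist_eq, hρ x hx.1, hρ y hy.1]
  obtain ⟨b, hb, hbb⟩ := hbound _ hc₁ (by rw [bd_push, hbs, bd_push, hbz,
    map_zero, map_zero, map_zero])
  have hrb : push (fun x : P.realization => r x) b ∈ On K (faceLists (P.restrict Iᶜ) (n + 1)) := by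
    refine push_mem (R := faceLists (P.restrict Iᶜ) (n + 1)) _ (fun l hl => ?_) hb
    have hrl : ∀ x ∈ l, r x ∉ I ∧ η ≤ x.1 (r x) := fun x hx => (hr x).2 (hηB x (hl.2.1 x hx))
    obtain ⟨a, ha⟩ : ∃ a, a ∈ l := List.exists_mem_of_length_pos (by rw [hl.1]; omega)
    obtain ⟨τ, hτ, hτa⟩ := a.2.2.2
    refine ⟨by rw [List.length_map, hl.1], P.down_closed hτ fun v hv => ?_, fun v hv => ?_⟩ <;>
      obtain ⟨x, hx, rfl⟩ := List.mem_map.mp (List.mem_toFinset.mp hv)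
    · rw [← hτa]
      have h1 := (dist_le_pi_dist a.1 x.1 (r x)).trans_lt (hl.2.2 a ha x hx)
      rw [Real.dist_eq, abs_lt] at h1
      linarith [(hrl x hx).2]
    · simpa using (hrl x hx).1
  obtain ⟨T, hT, hbT⟩ := exists_homotopy (K := K) (push r ∘ₗ s ∘ₗ push e) LinearMap.id
    (fun c => by simp [bd_push, hbs]) (fun c => rfl) (by simp [hs0])
    (fun l => {v | v ∈ l}) (fun l m hlm x hx => hlm.subset hx)
    (fun l hl => (List.exists_mem_of_ne_nil l hl))
    (fun l => by
      rw [LinearMap.comp_apply, LinearMap.comp_apply, push_single]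
      refine push_mem (R := lists l.length {v | v ∈ l}) _ (fun m hm => ?_) (hsl (l.map e))
      refine ⟨by rw [List.length_map, hm.1, List.length_map], fun v hv => ?_⟩
      obtain ⟨x, hx, rfl⟩ := List.mem_map.mp hv
      have hx' := convexHull_subset_simplexOn l (hm.2.1 x hx)
      by_contra hxl
      exact (hr x).1 (hsupp x hx'.1) (hx'.2 _ hxl))
    (fun l => single_mem (Q := lists l.length {v | v ∈ l}) ⟨rfl, fun _ hx => hx⟩ 1)
  have hTz : T z ∈ On K (faceLists (P.restrict Iᶜ) (n + 1)) := by
    refine map_mem T (fun l hl => On_mono (fun m hm => ?_) (hT l)) hz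
    refine ⟨by rw [hm.1, hl.1], (P.restrict Iᶜ).down_closed hl.2 fun v hv => ?_⟩
    exact List.mem_toFinset.mpr (hm.2 v (List.mem_toFinset.mp hv))
  refine ⟨push (fun x : P.realization => r x) b - T z, Submodule.sub_mem _ hrb hTz, ?_⟩
  have hρr : push ((fun x : P.realization => r x) ∘ ρ) (s (push e z)) = push r (s (push e z)) :=
    push_congr (fun l hl x hx => congrArg r (hρ x (hl.2.1 x hx).1)) hsz
  rw [map_sub, hbT z hbz, bd_push, hbb, push_push, hρr]
  simp

end Acyclic

lemma subsingleton_reducedHomology_of_neg (K : Type) [Field K] {V : Type} [LinearOrder V]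
    {Γ : ASC V} {j : ℤ} (hj : j + 1 < 0) :
    Subsingleton (ASC.reducedHomology K Γ j) := by
  have h1 : IsEmpty (ASC.Cells Γ j) := ⟨fun σ => by have := σ.2.2; omega⟩
  have h2 : Subsingleton (ASC.Chains K Γ j) :=
    inferInstanceAs (Subsingleton (ASC.Cells Γ j →₀ K))
  infer_instance

end ListChain

/-- Case 1 of the proof of Theorem 1.1: let `P` be a simplicial complex with `‖P‖ ≅ S^{d-1}`.
If `I` is a face of `P`, then `H̃_{d-1-i}(P_{≤Î}; K) = 0` for every integer `i ≥ 1`. -/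
theorem vanishing_of_face {V : Type} [Fintype V] [LinearOrder V]
    (K : Type) [Field K] (d : ℕ) (P : ASC V)
    (hP : Nonempty (↥(ASC.realization P) ≃ₜ
      ↥(Metric.sphere (0 : EuclideanSpace ℝ (Fin d)) 1)))
    (I : Finset V) (hI : I ∈ P.faces) (i : ℤ) (hi : 1 ≤ i) :
    Subsingleton (ASC.reducedHomology K (P.restrict Iᶜ) ((d : ℤ) - 1 - i)) := by
  obtain ⟨h⟩ := hP
  rcases lt_or_ge ((d : ℤ) - 1 - i + 1) 0 with hj | hj
  · exact ListChain.subsingleton_reducedHomology_of_neg K hj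
  · lift (d : ℤ) - 1 - i + 1 to ℕ using hj with n hn
    exact ListChain.subsingleton_reducedHomology hn fun z hz hbz =>
      ListChain.restrict_compl_acyclic h hI (by omega) hz hbz
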